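/- For every α ∈ (0,1) and 1 ≤ p, q ≤ ∞ (with the convention 1/∞ = 0), log H_{p,q}(α) = (1/p) ∫_ℝ 𝓟_α(x) log( 𝓟_α(x) / (1−α) ) dx + (1/q) ∫_ℝ 𝓟_{1−α}(x) log( 𝓟_{1−α}(x) / α ) dx. -/

import Mathlib

open MeasureTheory Complex Filter Set
open scoped Real ENNReal Topology

noncomputable section

def Strip : Set ℂ := {z : ℂ | 0 < z.im ∧ z.im < 1}

def bLine (h : ℂ → ℂ) (y : ℝ) : ℝ → ℂ := fun x => h (x + y * Complex.I)

def hardyNorm (p q : ℝ≥0∞) (h : ℂ → ℂ) : ℝ≥0∞ :=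
  ⨆ y ∈ Set.Ioo (0:ℝ) 1,
    ⨅ (f : ℝ → ℂ) (g : ℝ → ℂ) (_ : Measurable f) (_ : Measurable g)
      (_ : f + g = bLine h y),
      ENNReal.ofReal (1 - y)⁻¹ * eLpNorm f p volume +
        ENNReal.ofReal y⁻¹ * eLpNorm g q volume

def MemHardy (p q : ℝ≥0∞) (h : ℂ → ℂ) : Prop :=
  DifferentiableOn ℂ h Strip ∧ hardyNorm p q h < ⊤

def IsTrace0 (h : ℂ → ℂ) (v : ℝ → ℂ) : Prop :=
  ∀ φ : SchwartzMap ℝ ℂ,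
    Tendsto (fun y : ℝ => ∫ x : ℝ, h (x + y * Complex.I) * (starRingEnd ℂ) (φ x))
      (𝓝[>] (0:ℝ)) (𝓝 (∫ x : ℝ, v x * (starRingEnd ℂ) (φ x)))

def IsTrace1 (h : ℂ → ℂ) (w : ℝ → ℂ) : Prop :=
  ∀ φ : SchwartzMap ℝ ℂ,
    Tendsto (fun y : ℝ => ∫ x : ℝ, h (x + y * Complex.I) * (starRingEnd ℂ) (φ x))
      (𝓝[<] (1:ℝ)) (𝓝 (∫ x : ℝ, w x * (starRingEnd ℂ) (φ x)))

def ratioSet (p q : ℝ≥0∞) (α : ℝ) : Set ℝ :=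
  { r | ∃ (h : ℂ → ℂ) (h0 h1 : ℝ → ℂ), MemHardy p q h ∧ (∃ z ∈ Strip, h z ≠ 0) ∧
      IsTrace0 h h0 ∧ IsTrace1 h h1 ∧ MemLp h0 p volume ∧ MemLp h1 q volume ∧
      r = (eLpNorm (bLine h α) ⊤ volume).toReal /
        ((eLpNorm h0 p volume).toReal ^ (1 - α) * (eLpNorm h1 q volume).toReal ^ α) }

/-- `H_{p,q}(α)`: the optimal value of the generalized three lines problem. -/
def Hval (p q : ℝ≥0∞) (α : ℝ) : ℝ := sSup (ratioSet p q α)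

/-- The Poisson kernel of the strip. -/
def Pker (y x : ℝ) : ℝ :=
  Real.sin (Real.pi * y) / (2 * (Real.cosh (Real.pi * x) - Real.cos (Real.pi * y)))

lemma int_inv_line (v R : ℝ) (hv : v ≠ 0) :
    ∫ x in (-R)..R, ((x:ℂ) + v * I)⁻¹ = -(2 * Real.arctan (R / v) : ℝ) * I := by
  have key : ∀ x : ℝ, HasDerivAt
      (fun x : ℝ => (((1/2) * Real.log (x^2 + v^2) : ℝ) : ℂ) - (Real.arctan (x / v) : ℝ) * I)
      (((x:ℂ) + v * I)⁻¹) x := by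
    intro x
    have hpos : 0 < x^2 + v^2 := by positivity
    have h1 : HasDerivAt (fun x : ℝ => (1/2) * Real.log (x^2 + v^2)) (x / (x^2+v^2)) x := by
      have := (((hasDerivAt_id x).pow 2).add_const (v^2)).log (by simpa using hpos.ne')
      refine (this.const_mul (1/2)).congr_deriv ?_
      simp only [id]
      simp only [Pi.pow_apply, id]
      field_simp [hpos.ne']
      norm_num
    have h2 : HasDerivAt (fun x : ℝ => Real.arctan (x / v)) (v / (x^2+v^2)) x := by
      refine ((hasDerivAt_id' x).div_const v).arctan.congr_deriv ?_
      field_simp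
      ring
    refine (h1.ofReal_comp.sub (h2.ofReal_comp.mul_const I)).congr_deriv ?_
    symm
    have hne : (x:ℂ) + v * I ≠ 0 := by
      intro h
      have := congrArg Complex.im h
      simp at this; exact hv this
    rw [inv_eq_of_mul_eq_one_right]
    have : ((x:ℂ)^2 + (v:ℂ)^2) ≠ 0 := by exact_mod_cast hpos.ne'
    push_cast
    field_simp
    ring_nf
    rw [I_sq]; ring
  rw [intervalIntegral.integral_eq_sub_of_hasDerivAt (fun x _ => key x)]
  · simp [neg_div, Real.arctan_neg]; ring
  · apply Continuous.intervalIntegrable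
    apply Continuous.inv₀ (by fun_prop)
    intro x h
    have := congrArg Complex.im h
    simp at this; exact hv this

lemma arctan_lim_pos (v : ℝ) (hv : 0 < v) :
    Tendsto (fun R : ℝ => Real.arctan (R / v)) atTop (𝓝 (π/2)) :=
  (tendsto_nhds_of_tendsto_nhdsWithin Real.tendsto_arctan_atTop).comp
    (tendsto_id.atTop_div_const hv)

lemma arctan_lim_neg (v : ℝ) (hv : v < 0) :
    Tendsto (fun R : ℝ => Real.arctan (R / v)) atTop (𝓝 (-(π/2))) := by
  have := (arctan_lim_pos (-v) (by linarith)).neg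
  refine this.congr fun R => ?_
  rw [div_neg, Real.arctan_neg, neg_neg]

/-- vertical integrals of `N/(z - iα)` are controlled by those of `N` far away. -/
lemma cauchy_strip (a b α : ℝ) (ha : a < α) (hb : α < b) (V : Set ℂ) (hV : IsOpen V)
    (hsub : ∀ z : ℂ, a ≤ z.im → z.im ≤ b → z ∈ V) (N : ℂ → ℂ) (hN : DifferentiableOn ℂ N V)
    (C : ℝ) (hInteg : ∀ y ∈ Icc a b, Integrable (fun x : ℝ => N (x + y * I)))
    (hC : ∀ y ∈ Icc a b, ∫ x : ℝ, ‖N (x + y * I)‖ ≤ C) :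
    (∫ x : ℝ, N (x + a * I) / (x + a * I - α * I)) -
      (∫ x : ℝ, N (x + b * I) / (x + b * I - α * I)) = 2 * π * I * N (α * I) := by
  have hab : a ≤ b := by linarith
  have hcontV : ContinuousOn N V := hN.continuousOn
  have hne : ∀ z : ℂ, (z.im ≠ α ∨ z.re ≠ 0) → z - α * I ≠ 0 := by
    intro z hz h
    have h1 := congrArg Complex.im h
    have h2 := congrArg Complex.re h
    simp at h1 h2
    rcases hz with hz | hz
    · exact hz (by linarith)
    · exact hz h2
  let μ := (volume : Measure ℝ).prod (volume.restrict (Icc a b))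
  have hprod : Integrable (fun p : ℝ × ℝ => N (p.1 + p.2 * I)) μ := by
    have hmeas : AEStronglyMeasurable (fun p : ℝ × ℝ => N (p.1 + p.2 * I)) μ := by
      have : μ = (volume : Measure (ℝ × ℝ)).restrict (univ ×ˢ Icc a b) := by
        rw [Measure.volume_eq_prod, ← Measure.prod_restrict, Measure.restrict_univ]
      rw [this]
      apply ContinuousOn.aestronglyMeasurable _ (MeasurableSet.univ.prod measurableSet_Icc)
      apply hcontV.comp (by fun_prop)
      rintro ⟨x, y⟩ ⟨-, hy⟩
      exact hsub _ (by simpa using hy.1) (by simpa using hy.2)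
    rw [integrable_prod_iff' hmeas]
    constructor
    · filter_upwards [ae_restrict_mem measurableSet_Icc] with y hy using hInteg y hy
    · have hm := (hmeas.norm.prod_swap).integral_prod_right'
      refine Integrable.mono' (integrable_const C) hm ?_
      filter_upwards [ae_restrict_mem measurableSet_Icc] with y hy
      rw [Real.norm_of_nonneg (by positivity)]
      exact hC y hy
  let nu : ℝ → ℝ := fun R => ∫ y in Icc a b, ‖N (R + y * I)‖
  have hnu : Integrable nu := hprod.norm.integral_prod_left
  have hnu' : Integrable (fun R => nu (-R)) := hnu.comp_neg
  let M : ℂ → ℂ := fun z => N z / (z - α * I)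
  let hor : (ℂ → ℂ) → ℝ → ℂ := fun f R =>
    (∫ x : ℝ in (-R)..R, f (x + a * I)) - (∫ x : ℝ in (-R)..R, f (x + b * I))
  let ver : (ℂ → ℂ) → ℝ → ℂ := fun f R =>
    I • (∫ y : ℝ in a..b, f (R + y * I)) - I • (∫ y : ℝ in a..b, f (((-R:ℝ):ℂ) + y * I))
  let c : ℂ → ℂ := fun z => (z - α * I)⁻¹
  have hlc : ∀ y : ℝ, y ∈ Icc a b → y ≠ α → Continuous fun x : ℝ => N (x + y * I) := by
    intro y hy _
    exact continuousOn_univ.1 (hcontV.comp (by fun_prop)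
      (fun x _ => hsub _ (by simpa using hy.1) (by simpa using hy.2)))
  have hvc : ∀ R : ℝ, ContinuousOn (fun y : ℝ => N (R + y * I)) (uIcc a b) := by
    intro R
    refine hcontV.comp (by fun_prop) ?_
    intro y hy
    rw [uIcc_of_le hab] at hy
    exact hsub _ (by simpa using hy.1) (by simpa using hy.2)
  have hcl : ∀ y : ℝ, y ≠ α → Continuous fun x : ℝ => ((x:ℂ) + y * I - α * I)⁻¹ := by
    intro y hy
    exact Continuous.inv₀ (by fun_prop) (fun x => hne _ (Or.inl (by simpa using hy)))
  have hcv : ∀ R : ℝ, R ≠ 0 → Continuous fun y : ℝ => ((R:ℂ) + y * I - α * I)⁻¹ := by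
    intro R hR
    exact Continuous.inv₀ (by fun_prop) (fun x => hne _ (Or.inr (by simpa using hR)))
  have rect : ∀ R : ℝ, 0 < R → hor M R + ver M R = N (α * I) * (hor c R + ver c R) := by
    intro R hR
    have hmem : V ∈ 𝓝 ((α:ℂ) * I) := hV.mem_nhds (hsub _ (by simpa using ha.le) (by simpa using hb.le))
    have hg : DifferentiableOn ℂ (dslope N (α * I)) V :=
      (Complex.differentiableOn_dslope hmem).2 hN
    have H := Complex.integral_boundary_rect_eq_zero_of_differentiableOn (dslope N (α * I))
      ((-R:ℝ) + a * I) ((R:ℝ) + b * I) (hg.mono (by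
        rintro z ⟨-, hz⟩
        simp [uIcc_of_le hab] at hz
        exact hsub z hz.1 hz.2))
    have hd : ∀ z : ℂ, (z.im ≠ α ∨ z.re ≠ 0) →
        dslope N (α * I) z = M z - N (α * I) * c z := by
      intro z hz
      have h1 := hne z hz
      rw [dslope_of_ne _ (sub_ne_zero.1 h1), slope_def_field]
      simp only [M, c]
      field_simp
    have e1 : ∀ y ∈ Icc a b, y ≠ α → ∫ x : ℝ in (-R)..R, dslope N (α * I) (x + y * I) =
        (∫ x : ℝ in (-R)..R, M (x + y * I)) - N (α * I) * ∫ x : ℝ in (-R)..R, c (x + y * I) := by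
      intro y hy hya
      rw [← intervalIntegral.integral_const_mul, ← intervalIntegral.integral_sub]
      · exact intervalIntegral.integral_congr fun x _ => hd _ (Or.inl (by simpa using hya))
      · exact ((hlc y hy hya).mul (hcl y hya)).intervalIntegrable _ _
      · exact ((hcl y hya).const_mul _).intervalIntegrable _ _
    have e2 : ∀ R : ℝ, R ≠ 0 → ∫ y : ℝ in a..b, dslope N (α * I) (R + y * I) =
        (∫ y : ℝ in a..b, M (R + y * I)) - N (α * I) * ∫ y : ℝ in a..b, c (R + y * I) := by
      intro R hR
      rw [← intervalIntegral.integral_const_mul, ← intervalIntegral.integral_sub]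
      · exact intervalIntegral.integral_congr fun x _ => hd _ (Or.inr (by simpa using hR))
      · exact ((hvc R).mul (hcv R hR).continuousOn).intervalIntegrable
      · exact ((hcv R hR).const_mul _).intervalIntegrable _ _
    simp only [add_re, ofReal_re, mul_re, I_re, mul_zero, ofReal_im, I_im, mul_one, sub_self,
      add_zero, add_im, mul_im, zero_add, ofReal_re] at H
    rw [e1 a ⟨le_rfl, hab⟩ ha.ne, e1 b ⟨hab, le_rfl⟩ hb.ne', e2 R hR.ne',
      e2 (-R) (by linarith)] at H
    simp only [hor, ver]
    simp only [smul_eq_mul] at H ⊢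
    linear_combination H
  have vbound : ∀ R : ℝ, 1 ≤ |R| → ‖∫ y : ℝ in a..b, M (R + y * I)‖ ≤ nu R := by
    intro R hR
    have hR0 : R ≠ 0 := by rintro rfl; norm_num at hR
    rw [intervalIntegral.integral_of_le hab, ← integral_Icc_eq_integral_Ioc]
    refine norm_integral_le_of_norm_le ?_ ?_
    · have := (hvc R).norm.intervalIntegrable (μ := volume)
      rw [intervalIntegrable_iff_integrableOn_Icc_of_le hab] at this
      exact this
    · refine Eventually.of_forall fun y => ?_
      simp only [M, norm_div]
      apply div_le_self (norm_nonneg _)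
      refine hR.trans ?_
      have := Complex.abs_re_le_norm ((R:ℂ) + y * I - α * I)
      simpa using this
  have hverc : Tendsto (ver c) atTop (𝓝 0) := by
    have hb1 : ∀ R : ℝ, R ≠ 0 → ‖∫ y : ℝ in a..b, c (R + y * I)‖ ≤ |R|⁻¹ * |b - a| := by
      intro R hR
      apply intervalIntegral.norm_integral_le_of_norm_le_const
      intro y _
      simp only [c, norm_inv]
      apply inv_anti₀ (by positivity)
      have := Complex.abs_re_le_norm ((R:ℂ) + y * I - α * I)
      simpa using this
    apply squeeze_zero_norm' (a := fun R : ℝ => R⁻¹ * |b - a| + R⁻¹ * |b - a|)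
    · filter_upwards [eventually_gt_atTop 0] with R hR
      refine (norm_sub_le _ _).trans ?_
      rw [norm_smul, norm_smul, norm_I, one_mul, one_mul]
      have h1 := hb1 R hR.ne'
      have h2 := hb1 (-R) (by linarith)
      rw [abs_neg] at h2
      rw [abs_of_pos hR] at h1 h2
      exact add_le_add h1 h2
    · have := (tendsto_inv_atTop_zero (𝕜 := ℝ)).mul_const |b - a|
      simpa using this.add this
  have hhorc : Tendsto (hor c) atTop (𝓝 (2 * π * I)) := by
    have e : ∀ R, hor c R = -(2 * Real.arctan (R / (a - α)) : ℝ) * I -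
        -(2 * Real.arctan (R / (b - α)) : ℝ) * I := by
      intro R
      rw [← int_inv_line (a - α) R (by linarith), ← int_inv_line (b - α) R (by linarith)]
      simp only [hor, c]
      congr 1 <;>
      · refine intervalIntegral.integral_congr fun x _ => ?_
        push_cast
        ring_nf
    have h1 := arctan_lim_neg (a - α) (by linarith)
    have h2 := arctan_lim_pos (b - α) (by linarith)
    have h3 := ((h2.const_mul 2).sub (h1.const_mul 2))
    have h4 := ((Complex.continuous_ofReal.tendsto _).comp h3).mul_const I
    refine (h4.congr fun R => ?_).trans_eq ?_ 
    · rw [e]; simp only [Function.comp]; push_cast; ring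
    · congr 1; push_cast; ring
  have hMint : ∀ y ∈ Icc a b, y ≠ α → Integrable fun x : ℝ => M (x + y * I) := by
    intro y hy hya
    have hpos : 0 < |y - α| := abs_pos.2 (sub_ne_zero.2 hya)
    refine Integrable.mono' ((hInteg y hy).norm.mul_const |y - α|⁻¹)
      ((hlc y hy hya).mul (hcl y hya)).aestronglyMeasurable (Eventually.of_forall fun x => ?_)
    simp only [M]
    rw [norm_div, div_eq_mul_inv]
    gcongr
    have := Complex.abs_im_le_norm ((x:ℂ) + y * I - α * I)
    simpa using this
  have hhorM : Tendsto (hor M) atTop (𝓝 ((∫ x : ℝ, M (x + a * I)) - ∫ x : ℝ, M (x + b * I))) := by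
    apply Tendsto.sub
    · exact intervalIntegral_tendsto_integral (hMint a ⟨le_rfl, hab⟩ ha.ne) tendsto_neg_atTop_atBot
        tendsto_id
    · exact intervalIntegral_tendsto_integral (hMint b ⟨hab, le_rfl⟩ hb.ne') tendsto_neg_atTop_atBot
        tendsto_id
  have hverM : Tendsto (ver M) atTop (𝓝 (N (α * I) * (2 * π * I + 0) -
      ((∫ x : ℝ, M (x + a * I)) - ∫ x : ℝ, M (x + b * I)))) := by
    refine (((hhorc.add hverc).const_mul (N (α * I))).sub hhorM).congr' ?_
    filter_upwards [eventually_gt_atTop 0] with R hR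
    rw [← rect R hR]; ring
  have hlim : N (α * I) * (2 * π * I + 0) -
      ((∫ x : ℝ, M (x + a * I)) - ∫ x : ℝ, M (x + b * I)) = 0 := by
    set L := N (α * I) * (2 * π * I + 0) -
      ((∫ x : ℝ, M (x + a * I)) - ∫ x : ℝ, M (x + b * I))
    by_contra hL
    have hLpos : 0 < ‖L‖ := norm_pos_iff.2 hL
    have hI : Integrable (fun R => nu R + nu (-R)) := hnu.add hnu'
    have hev : ∀ᶠ R in atTop, ‖L‖ / 2 ≤ nu R + nu (-R) := by
      filter_upwards [hverM.norm.eventually (lt_mem_nhds (half_lt_self hLpos)),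
        eventually_ge_atTop 1] with R h1 h2
      refine h1.le.trans ((norm_sub_le _ _).trans ?_)
      rw [norm_smul, norm_smul, norm_I, one_mul, one_mul]
      refine add_le_add (vbound R (by rw [abs_of_nonneg] <;> linarith)) (vbound (-R) ?_)
      rw [abs_neg, abs_of_nonneg] <;> linarith
    obtain ⟨T, hT⟩ := eventually_atTop.1 hev
    have hc : IntegrableOn (fun _ : ℝ => ‖L‖ / 2) (Ici T) := by
      refine Integrable.mono' hI.integrableOn aestronglyMeasurable_const ?_
      filter_upwards [ae_restrict_mem measurableSet_Ici] with R hR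
      rw [Real.norm_of_nonneg (by positivity)]
      exact hT R hR
    rw [integrableOn_const_iff] at hc
    rcases hc with h | h
    · simp at h; exact hL h
    · simp at h
  linear_combination (-1 : ℂ) * hlim

def Ust (α : ℝ) : Set ℂ := {z | -(α/2) < z.im ∧ z.im < 1 + (1-α)/2}
def Sbig (α : ℝ) : Set ℂ := {z | -α < z.im ∧ z.im < 2 - α}
def Dk (α : ℝ) (z : ℂ) : ℂ := Complex.cosh (π * z) - Real.cos (π * α)
def dk (α : ℝ) : ℂ → ℂ := dslope (Dk α) (α * I)
def mker (α : ℝ) (z : ℂ) : ℂ := Real.sin (π * α) / (2 * dk α z)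

lemma isOpen_Ust (α : ℝ) : IsOpen (Ust α) :=
  (isOpen_lt continuous_const continuous_im).inter (isOpen_lt continuous_im continuous_const)
lemma isOpen_Sbig (α : ℝ) : IsOpen (Sbig α) :=
  (isOpen_lt continuous_const continuous_im).inter (isOpen_lt continuous_im continuous_const)

lemma Ust_sub {α : ℝ} (hα : α ∈ Ioo (0:ℝ) 1) : Ust α ⊆ Sbig α := by
  rintro z ⟨h1, h2⟩
  exact ⟨by linarith [hα.1], by linarith [hα.2]⟩

lemma closed_sub_Ust {α : ℝ} (hα : α ∈ Ioo (0:ℝ) 1) (z : ℂ) (h0 : 0 ≤ z.im) (h1 : z.im ≤ 1) :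
    z ∈ Ust α := ⟨by linarith [hα.1], by linarith [hα.2]⟩

lemma convex_Sbig (α : ℝ) : Convex ℝ (Sbig α) :=
  (convex_halfSpace_im_gt (-α)).inter (convex_halfSpace_im_lt (2 - α))
lemma convex_Ust (α : ℝ) : Convex ℝ (Ust α) :=
  (convex_halfSpace_im_gt _).inter (convex_halfSpace_im_lt _)

lemma sin_pos' {α : ℝ} (hα : α ∈ Ioo (0:ℝ) 1) : 0 < Real.sin (π * α) :=
  Real.sin_pos_of_pos_of_lt_pi (mul_pos Real.pi_pos hα.1)
    (by nlinarith [Real.pi_pos, hα.2])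

lemma Dk_zero {α : ℝ} {z : ℂ} (hz : z ∈ Sbig α) (hα : α ∈ Ioo (0:ℝ) 1)
    (h : Dk α z = 0) : z = α * I := by
  unfold Dk at h
  rw [sub_eq_zero, ← Complex.cos_mul_I, Complex.ofReal_cos, Complex.cos_eq_cos_iff] at h
  obtain ⟨k, h | h⟩ := h
  · have h1 := congrArg Complex.re h
    have h2 := congrArg Complex.im h
    simp at h1 h2
    have hk : z.im = 2 * k - α := by
      have := Real.pi_pos
      have h3 : π * (z.im - (2 * k - α)) = 0 := by linarith
      rcases mul_eq_zero.1 h3 with h4 | h4 <;> linarith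
    have hk0 : (0:ℝ) < k := by linarith [hz.1]
    have hk1 : (k:ℝ) < 1 := by linarith [hz.2]
    have : (0:ℤ) < k := by exact_mod_cast hk0
    have : k < (1:ℤ) := by exact_mod_cast hk1
    omega
  · have h1 := congrArg Complex.re h
    have h2 := congrArg Complex.im h
    simp at h1 h2
    have hre : z.re = 0 := h2
    have hk : z.im = α - 2 * k := by
      have := Real.pi_pos
      have h3 : π * (z.im - (α - 2 * k)) = 0 := by linarith
      rcases mul_eq_zero.1 h3 with h4 | h4 <;> linarith
    have hk0 : (-1:ℝ) < k := by linarith [hz.2, hα.1]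
    have hk1 : (k:ℝ) < 1 := by linarith [hz.1, hα.2]
    have h5 : (-1:ℤ) < k := by exact_mod_cast hk0
    have h6 : k < (1:ℤ) := by exact_mod_cast hk1
    have h7 : k = 0 := by omega
    apply Complex.ext
    · simp [hre]
    · simp [hk, h7]

lemma Dk_hasDeriv (α : ℝ) (z : ℂ) : HasDerivAt (Dk α) (π * Complex.sinh (π * z)) z := by
  unfold Dk
  have h : HasDerivAt (fun z : ℂ => (π:ℂ) * z) (π * 1) z := (hasDerivAt_id z).const_mul _
  refine (h.ccosh.sub_const _).congr_deriv ?_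
  ring

lemma Dk_self (α : ℝ) : Dk α (α * I) = 0 := by
  unfold Dk
  rw [← mul_assoc, Complex.cosh_mul_I]; push_cast; ring

lemma dk_self (α : ℝ) : dk α (α * I) = π * Real.sin (π * α) * I := by
  unfold dk
  rw [dslope_same, (Dk_hasDeriv α _).deriv, ← mul_assoc, Complex.sinh_mul_I]; push_cast; ring

lemma dk_of_ne {α : ℝ} {z : ℂ} (hz : z ≠ α * I) : dk α z = Dk α z / (z - α * I) := by
  unfold dk
  rw [dslope_of_ne _ hz, slope_def_field, Dk_self, sub_zero]

lemma dk_ne {α : ℝ} (hα : α ∈ Ioo (0:ℝ) 1) {z : ℂ} (hz : z ∈ Sbig α) : dk α z ≠ 0 := by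
  by_cases h : z = α * I
  · rw [h, dk_self]
    have h1 : (Real.sin (π * α) : ℂ) ≠ 0 := by exact_mod_cast (sin_pos' hα).ne'
    have h2 : (π:ℂ) ≠ 0 := by exact_mod_cast Real.pi_ne_zero
    exact mul_ne_zero (mul_ne_zero h2 h1) I_ne_zero
  · rw [dk_of_ne h]
    exact div_ne_zero (fun h' => h (Dk_zero hz hα h')) (sub_ne_zero.2 h)

lemma dk_diff (α : ℝ) : Differentiable ℂ (dk α) := by
  rw [← differentiableOn_univ]
  exact (Complex.differentiableOn_dslope univ_mem).2
    (fun z _ => (Dk_hasDeriv α z).differentiableAt.differentiableWithinAt)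

lemma mk_diff {α : ℝ} (hα : α ∈ Ioo (0:ℝ) 1) : DifferentiableOn ℂ (mker α) (Sbig α) := by
  intro z hz
  unfold mker
  exact ((differentiableAt_const _).div ((dk_diff α z).const_mul 2)
    (mul_ne_zero two_ne_zero (dk_ne hα hz))).differentiableWithinAt

lemma mk_self {α : ℝ} (hα : α ∈ Ioo (0:ℝ) 1) : 2 * π * I * mker α (α * I) = 1 := by
  unfold mker
  rw [dk_self]
  have h1 : (Real.sin (π * α) : ℂ) ≠ 0 := by exact_mod_cast (sin_pos' hα).ne'
  have h2 : (π:ℂ) ≠ 0 := by exact_mod_cast Real.pi_ne_zero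
  have := I_ne_zero
  field_simp

lemma mk_div {α : ℝ} {z : ℂ} (hz : z ≠ α * I) :
    mker α z / (z - α * I) = Real.sin (π * α) / (2 * Dk α z) := by
  unfold mker
  rw [dk_of_ne hz]
  have : z - α * I ≠ 0 := sub_ne_zero.2 hz
  rw [div_div, mul_assoc, div_mul_cancel₀ _ this]

lemma mk_bot {α : ℝ} (hα : α ∈ Ioo (0:ℝ) 1) (x : ℝ) :
    mker α (x + (0:ℝ) * I) / (x + (0:ℝ) * I - α * I) = Pker α x := by
  rw [mk_div]
  · unfold Dk Pker; push_cast; simp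
  · intro h
    have := congrArg Complex.im h
    simp at this
    linarith [hα.1]

lemma mk_top {α : ℝ} (hα : α ∈ Ioo (0:ℝ) 1) (x : ℝ) :
    mker α (x + (1:ℝ) * I) / (x + (1:ℝ) * I - α * I) = -Pker (1 - α) x := by
  rw [mk_div]
  · unfold Dk Pker
    have h1 : Complex.cosh (π * (x + (1:ℝ) * I)) = - Complex.cosh (π * x) := by
      rw [mul_add, Complex.cosh_add]; simp [Complex.cosh_mul_I, Complex.sinh_mul_I]
    have h2 : Real.sin (π * (1 - α)) = Real.sin (π * α) := by
      rw [mul_sub, mul_one, Real.sin_pi_sub]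
    have h3 : Real.cos (π * (1 - α)) = -Real.cos (π * α) := by
      rw [mul_sub, mul_one, Real.cos_pi_sub]
    rw [h1, h2, h3]
    push_cast
    rw [← div_neg]
    congr 1; ring
  · intro h
    have := congrArg Complex.im h
    simp at this
    linarith [hα.2]

lemma norm_cosh_ge (w : ℂ) : Real.sinh |w.re| ≤ ‖Complex.cosh w‖ := by
  have h : ∀ w : ℂ, Real.sinh w.re ≤ ‖Complex.cosh w‖ := by
    intro w
    rw [Complex.cosh, Real.sinh_eq, norm_div]
    have := norm_sub_norm_le (Complex.exp w) (-Complex.exp (-w))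
    rw [sub_neg_eq_add, norm_neg, Complex.norm_exp, Complex.norm_exp, neg_re] at this
    simp only [Complex.norm_ofNat]
    linarith
  rcases le_total 0 w.re with h0 | h0
  · rw [abs_of_nonneg h0]; exact h w
  · rw [abs_of_nonpos h0]; simpa using h (-w)

lemma norm_sinh_le (w : ℂ) : ‖Complex.sinh w‖ ≤ Real.sinh |w.re| + 1 := by
  have h : ‖Complex.sinh w‖ ≤ Real.cosh w.re := by
    rw [Complex.sinh, Real.cosh_eq, norm_div]
    have := norm_sub_le (Complex.exp w) (Complex.exp (-w))
    rw [Complex.norm_exp, Complex.norm_exp, neg_re] at this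
    simp only [Complex.norm_ofNat]
    linarith
  rw [← Real.cosh_abs] at h
  have h2 : Real.cosh |w.re| - Real.sinh |w.re| ≤ 1 := by
    rw [Real.cosh_sub_sinh]; exact Real.exp_le_one_iff.2 (by simp)
  linarith

lemma Dk_ge (α : ℝ) (z : ℂ) : Real.sinh (π * |z.re|) - 1 ≤ ‖Dk α z‖ := by
  unfold Dk
  have h1 := norm_sub_norm_le (Complex.cosh (π * z)) (Real.cos (π * α) : ℂ)
  have h2 := norm_cosh_ge (π * z)
  have h3 : ‖(Real.cos (π * α) : ℂ)‖ ≤ 1 := by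
    rw [Complex.norm_real]; exact Real.abs_cos_le_one _
  have h4 : |((π:ℂ) * z).re| = π * |z.re| := by
    simp [abs_mul, abs_of_pos Real.pi_pos]
  rw [h4] at h2
  linarith

lemma sinh_ge {t : ℝ} (ht : 1 ≤ t) : Real.exp (2 * t) ≤ Real.sinh (π * t) - 1 := by
  have hpi := Real.pi_gt_three
  rw [Real.sinh_eq]
  have he := Real.exp_one_gt_d9
  have h1 : Real.exp 1 * Real.exp (2 * t) ≤ Real.exp (π * t) := by
    rw [← Real.exp_add]; apply Real.exp_le_exp.2; nlinarith
  have h2 : Real.exp (-(π * t)) ≤ 1 := Real.exp_le_one_iff.2 (by nlinarith)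
  have h3 : Real.exp 1 * Real.exp 1 ≤ Real.exp (2 * t) := by
    rw [← Real.exp_add]; apply Real.exp_le_exp.2; linarith
  nlinarith

lemma norm_le_re_im (z : ℂ) : ‖z‖ ≤ |z.re| + |z.im| := Complex.norm_le_abs_re_add_abs_im z

lemma cpt (α : ℝ) : IsCompact ((uIcc (-1:ℝ) 1) ×ℂ (uIcc (-(α/2)) (1 + (1-α)/2))) :=
  isCompact_uIcc.reProdIm isCompact_uIcc

lemma cpt_sub {α : ℝ} (hα : α ∈ Ioo (0:ℝ) 1) :
    ((uIcc (-1:ℝ) 1) ×ℂ (uIcc (-(α/2)) (1 + (1-α)/2))) ⊆ Sbig α := by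
  rintro z ⟨-, hz⟩
  have : -(α/2) ≤ 1 + (1-α)/2 := by linarith [hα.1, hα.2]
  simp [uIcc_of_le this] at hz
  exact ⟨by linarith [hα.1], by linarith [hα.2]⟩

lemma mem_cpt {α : ℝ} {z : ℂ} (hz : z ∈ Ust α) (h : |z.re| ≤ 1) :
    z ∈ ((uIcc (-1:ℝ) 1) ×ℂ (uIcc (-(α/2)) (1 + (1-α)/2))) := by
  rw [mem_reProdIm]
  rw [abs_le] at h
  have : -(α/2) ≤ 1 + (1-α)/2 := by linarith [hz.1, hz.2]
  rw [uIcc_of_le this, uIcc_of_le (by norm_num : (-1:ℝ) ≤ 1)]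
  exact ⟨h, hz.1.le, hz.2.le⟩

lemma mk_bound {α : ℝ} (hα : α ∈ Ioo (0:ℝ) 1) :
    ∃ C, 0 ≤ C ∧ ∀ z ∈ Ust α, ‖mker α z‖ ≤ C * Real.exp (-|z.re|) := by
  obtain ⟨C, hC⟩ := (cpt α).exists_bound_of_continuousOn
    ((mk_diff hα).continuousOn.mono (cpt_sub hα))
  refine ⟨max C 0 * Real.exp 1 + 3, by positivity, fun z hz => ?_⟩
  rcases le_total |z.re| 1 with h | h
  · have h1 := hC z (mem_cpt hz h)
    have h2 : 1 ≤ Real.exp 1 * Real.exp (-|z.re|) := by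
      rw [← Real.exp_add]; apply Real.one_le_exp; linarith
    have h3 : 0 < Real.exp (-|z.re|) := Real.exp_pos _
    have h4 : C ≤ max C 0 := le_max_left _ _
    have h5 : 0 ≤ max C 0 := le_max_right _ _
    nlinarith
  · have hne : z ≠ α * I := by
      rintro rfl; simp at h; linarith
    have h1 := Dk_ge α z
    have h2 := sinh_ge h
    have hD : Real.exp (2 * |z.re|) ≤ ‖Dk α z‖ := by linarith
    have h3 : mker α z = Real.sin (π * α) * (z - α * I) / (2 * Dk α z) := by
      unfold mker; rw [dk_of_ne hne]; field_simp
    have h4 : ‖z - α * I‖ ≤ |z.re| + 2 := by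
      refine (norm_le_re_im _).trans ?_
      simp
      rw [abs_le]
      exact ⟨by linarith [hz.1, hα.1, hα.2], by linarith [hz.2, hα.1]⟩
    have h5 : |z.re| + 2 ≤ 3 * Real.exp |z.re| := by
      have := Real.add_one_le_exp |z.re|; linarith
    have h6 : ‖(Real.sin (π * α) : ℂ)‖ ≤ 1 := by
      rw [Complex.norm_real]; exact Real.abs_sin_le_one _
    rw [h3, norm_div, norm_mul, norm_mul, Complex.norm_ofNat]
    have hpos : 0 < Real.exp (2 * |z.re|) := Real.exp_pos _
    rw [div_le_iff₀ (by linarith)]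
    have h7 : Real.exp |z.re| = Real.exp (-|z.re|) * Real.exp (2 * |z.re|) := by
      rw [← Real.exp_add]; congr 1; ring
    have h8 : ‖(Real.sin (π * α) : ℂ)‖ * ‖z - α * I‖ ≤ 3 * Real.exp |z.re| := by
      have := norm_nonneg (z - α * I)
      nlinarith
    refine h8.trans ?_
    rw [h7]
    have h9 : 0 < Real.exp (-|z.re|) := Real.exp_pos _
    have h10 : 3 ≤ (max C 0 * Real.exp 1 + 3) := by
      have : 0 ≤ max C 0 * Real.exp 1 := by positivity
      linarith
    calc 3 * (Real.exp (-|z.re|) * Real.exp (2 * |z.re|)) =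
        3 * Real.exp (-|z.re|) * Real.exp (2 * |z.re|) := by ring
      _ ≤ (max C 0 * Real.exp 1 + 3) * Real.exp (-|z.re|) * (2 * ‖Dk α z‖) := by
        apply mul_le_mul (mul_le_mul_of_nonneg_right h10 h9.le) (by linarith) hpos.le (by positivity)

lemma quad_exp (t : ℝ) (ht : 0 ≤ t) : 1 + (t + 2)^2 ≤ 8 * Real.exp (t / 2) := by
  have := Real.quadratic_le_exp_of_nonneg (x := t / 2) (by positivity)
  nlinarith

lemma integrable_exp_half : Integrable fun x : ℝ => Real.exp (-(|x| / 2)) := by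
  refine Integrable.mono' (integrable_inv_one_add_sq.const_mul 8) (by fun_prop)
    (Eventually.of_forall fun x => ?_)
  rw [Real.norm_of_nonneg (Real.exp_pos _).le, Real.exp_neg, ← div_eq_mul_inv,
    le_div_iff₀ (by positivity), inv_mul_le_iff₀ (Real.exp_pos _)]
  have := quad_exp |x| (abs_nonneg x)
  have h2 := sq_abs x
  nlinarith [abs_nonneg x]

lemma integrable_exp_abs : Integrable fun x : ℝ => Real.exp (-|x|) := by
  refine Integrable.mono' integrable_exp_half (by fun_prop)
    (Eventually.of_forall fun x => ?_)
  rw [Real.norm_of_nonneg (Real.exp_pos _).le]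
  exact Real.exp_le_exp.2 (by linarith [abs_nonneg x])

lemma Pker_pos {α : ℝ} (hα : α ∈ Ioo (0:ℝ) 1) (x : ℝ) : 0 < Pker α x := by
  unfold Pker
  have h1 := sin_pos' hα
  have h2 : Real.cos (π * α) < 1 := by
    rw [← Real.cos_zero]
    exact Real.cos_lt_cos_of_nonneg_of_le_pi le_rfl (by nlinarith [Real.pi_pos, hα.2])
      (mul_pos Real.pi_pos hα.1)
  have h3 := Real.one_le_cosh (π * x)
  exact div_pos h1 (by linarith)

lemma Pker_cont {α : ℝ} (hα : α ∈ Ioo (0:ℝ) 1) : Continuous (Pker α) := by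
  have h : ∀ x, 2 * (Real.cosh (π * x) - Real.cos (π * α)) ≠ 0 := by
    intro x h0
    have := Pker_pos hα x
    unfold Pker at this
    rw [h0] at this; simp at this
  unfold Pker
  exact Continuous.div (by fun_prop) (by fun_prop) h

lemma Ust_norm {α : ℝ} (hα : α ∈ Ioo (0:ℝ) 1) {z : ℂ} (hz : z ∈ Ust α) : ‖z‖ ≤ |z.re| + 2 := by
  refine (norm_le_re_im _).trans ?_
  have : |z.im| ≤ 2 := by
    rw [abs_le]; exact ⟨by linarith [hz.1, hα.2], by linarith [hz.2, hα.1]⟩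
  linarith

lemma poisson {α : ℝ} (hα : α ∈ Ioo (0:ℝ) 1) (G : ℂ → ℂ) (hG : DifferentiableOn ℂ G (Ust α))
    (C : ℝ) (hC : ∀ z ∈ Ust α, ‖G z‖ ≤ C * (1 + ‖z‖^2)) :
    Integrable (fun x : ℝ => Pker α x * G (x + (0:ℝ) * I)) ∧
    Integrable (fun x : ℝ => Pker (1 - α) x * G (x + (1:ℝ) * I)) ∧
    (∫ x : ℝ, Pker α x * G (x + (0:ℝ) * I)) + (∫ x : ℝ, Pker (1 - α) x * G (x + (1:ℝ) * I))
      = G (α * I) := by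
  obtain ⟨B, hB0, hB⟩ := mk_bound hα
  have hC0 : 0 ≤ C := by
    have := (norm_nonneg _).trans (hC 0 (closed_sub_Ust hα 0 (by simp) (by simp)))
    simpa using this
  let N : ℂ → ℂ := fun z => G z * mker α z
  have hN : DifferentiableOn ℂ N (Ust α) := hG.mul ((mk_diff hα).mono (Ust_sub hα))
  have hNb : ∀ z ∈ Ust α, ‖N z‖ ≤ 8 * C * B * Real.exp (-(|z.re| / 2)) := by
    intro z hz
    simp only [N, norm_mul]
    have h1 := hC z hz
    have h2 := hB z hz
    have h3 := Ust_norm hα hz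
    have h4 := quad_exp |z.re| (abs_nonneg _)
    have h5 : 1 + ‖z‖^2 ≤ 8 * Real.exp (|z.re| / 2) := by
      have : ‖z‖^2 ≤ (|z.re| + 2)^2 := by gcongr
      linarith
    calc ‖G z‖ * ‖mker α z‖ ≤ (C * (8 * Real.exp (|z.re| / 2))) * (B * Real.exp (-|z.re|)) := by
          apply mul_le_mul (h1.trans (mul_le_mul_of_nonneg_left h5 hC0)) h2 (norm_nonneg _)
            (by positivity)
      _ = 8 * C * B * (Real.exp (|z.re| / 2) * Real.exp (-|z.re|)) := by ring
      _ = 8 * C * B * Real.exp (-(|z.re| / 2)) := by rw [← Real.exp_add]; congr 2; ring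
  have hmem : ∀ y ∈ Icc (0:ℝ) 1, ∀ x : ℝ, (x:ℂ) + y * I ∈ Ust α := by
    intro y hy x
    exact closed_sub_Ust hα _ (by simpa using hy.1) (by simpa using hy.2)
  have hcont : ∀ y ∈ Icc (0:ℝ) 1, Continuous fun x : ℝ => N (x + y * I) := by
    intro y hy
    exact continuousOn_univ.1 (hN.continuousOn.comp (by fun_prop) (fun x _ => hmem y hy x))
  have hInteg : ∀ y ∈ Icc (0:ℝ) 1, Integrable fun x : ℝ => N (x + y * I) := by
    intro y hy
    refine Integrable.mono' (integrable_exp_half.const_mul (8 * C * B))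
      (hcont y hy).aestronglyMeasurable (Eventually.of_forall fun x => ?_)
    simpa using hNb _ (hmem y hy x)
  have key := cauchy_strip 0 1 α hα.1 hα.2 (Ust α) (isOpen_Ust α) (closed_sub_Ust hα) N hN
    (∫ x : ℝ, 8 * C * B * Real.exp (-(|x| / 2))) hInteg (by
      intro y hy
      refine integral_mono (hInteg y hy).norm (integrable_exp_half.const_mul _) fun x => ?_
      simpa using hNb _ (hmem y hy x))
  have e0 : ∀ x : ℝ, N (x + (0:ℝ) * I) / (x + (0:ℝ) * I - α * I) =
      Pker α x * G (x + (0:ℝ) * I) := by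
    intro x
    rw [← mk_bot hα x]; simp only [N]; ring
  have e1 : ∀ x : ℝ, N (x + (1:ℝ) * I) / (x + (1:ℝ) * I - α * I) =
      -(Pker (1 - α) x * G (x + (1:ℝ) * I)) := by
    intro x
    have := mk_top hα x
    rw [show (Pker (1 - α) x : ℂ) = -(mker α (x + (1:ℝ) * I) / (x + (1:ℝ) * I - α * I)) by
      rw [this]; ring]
    simp only [N]; ring
  have h01 : (0:ℝ) ∈ Icc (0:ℝ) 1 := by simp
  have h11 : (1:ℝ) ∈ Icc (0:ℝ) 1 := by simp
  have hα' : 1 - α ∈ Ioo (0:ℝ) 1 := ⟨by linarith [hα.2], by linarith [hα.1]⟩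
  have hGc : ∀ y ∈ Icc (0:ℝ) 1, Continuous fun x : ℝ => G (x + y * I) := by
    intro y hy
    exact continuousOn_univ.1 (hG.continuousOn.comp (by fun_prop) (fun x _ => hmem y hy x))
  have i0 : Integrable (fun x : ℝ => Pker α x * G (x + (0:ℝ) * I)) := by
    refine Integrable.mono' ((hInteg 0 h01).norm.mul_const α⁻¹)
      (((Complex.continuous_ofReal.comp (Pker_cont hα))).mul (hGc 0 h01)).aestronglyMeasurable
      (Eventually.of_forall fun x => ?_)
    rw [← e0, norm_div, div_eq_mul_inv]
    have := Complex.abs_im_le_norm ((x:ℂ) + (0:ℝ) * I - α * I)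
    have h2 : |((x:ℂ) + (0:ℝ) * I - α * I).im| = α := by simp [abs_of_pos hα.1]
    have := hα.1
    gcongr
    linarith
  have i1 : Integrable (fun x : ℝ => Pker (1 - α) x * G (x + (1:ℝ) * I)) := by
    refine Integrable.mono' ((hInteg 1 h11).norm.mul_const (1-α)⁻¹)
      (((Complex.continuous_ofReal.comp (Pker_cont hα'))).mul (hGc 1 h11)).aestronglyMeasurable
      (Eventually.of_forall fun x => ?_)
    rw [← norm_neg, ← e1, norm_div, div_eq_mul_inv]
    have := Complex.abs_im_le_norm ((x:ℂ) + (1:ℝ) * I - α * I)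
    have h2 : |((x:ℂ) + (1:ℝ) * I - α * I).im| = 1 - α := by simp; linarith [hα.2]
    have := hα'.1
    gcongr
    linarith
  refine ⟨i0, i1, ?_⟩
  simp_rw [e0, e1] at key
  rw [integral_neg, sub_neg_eq_add] at key
  rw [key]
  simp only [N]
  have := mk_self hα
  linear_combination G (α * I) * this

lemma Pker_integral' {α : ℝ} (hα : α ∈ Ioo (0:ℝ) 1) :
    Integrable (Pker (1 - α)) ∧ ∫ x, Pker (1 - α) x = α := by
  have hb : ∀ z ∈ Ust α, ‖z‖ ≤ 1 * (1 + ‖z‖^2) := by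
    intro z _; nlinarith [sq_nonneg (‖z‖ - 1), norm_nonneg z]
  obtain ⟨i0, i1, h⟩ := poisson hα (fun z => z) differentiableOn_id 1 hb
  have hi : Integrable (Pker (1 - α)) := by
    refine i1.im.congr (Eventually.of_forall fun x => ?_)
    simp
  refine ⟨hi, ?_⟩
  have h' := congrArg Complex.im h
  rw [Complex.add_im] at h'
  have f0 := integral_im i0
  have f1 := integral_im i1
  simp only [RCLike.im_eq_complex_im] at f0 f1
  rw [← f0, ← f1] at h'
  simpa using h'

lemma Pker_integral {α : ℝ} (hα : α ∈ Ioo (0:ℝ) 1) :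
    Integrable (Pker α) ∧ ∫ x, Pker α x = 1 - α := by
  have := Pker_integral' (α := 1 - α) ⟨by linarith [hα.2], by linarith [hα.1]⟩
  simpa using this

lemma exists_primitive (s : Set ℂ) (hs : Convex ℝ s) (ho : IsOpen s) (f : ℂ → ℂ)
    (hf : DifferentiableOn ℂ f s) : ∃ F : ℂ → ℂ, ∀ z ∈ s, HasDerivAt F (f z) z := by
  let ω : ℂ → ℂ →L[ℂ] ℂ := fun z => ContinuousLinearMap.toSpanSingletonCLE (𝕜 := ℂ) (f z)
  have hfd : ∀ z ∈ s, HasFDerivAt ω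
      ((ContinuousLinearMap.toSpanSingletonCLE (𝕜 := ℂ) (E := ℂ)).toContinuousLinearMap.restrictScalars ℝ ∘L
      ((fderiv ℂ f z).restrictScalars ℝ)) z := by
    intro z hz
    have h1 := ((hf.differentiableAt (ho.mem_nhds hz)).hasFDerivAt).restrictScalars ℝ
    exact ((ContinuousLinearMap.toSpanSingletonCLE (𝕜 := ℂ) (E := ℂ)).toContinuousLinearMap.restrictScalars ℝ).hasFDerivAt.comp z h1
  obtain ⟨F, hF⟩ := hs.exists_forall_hasFDerivAt_of_fderiv_symmetric ho (ω := ω)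
    (fun z hz => (hfd z hz).differentiableAt.differentiableWithinAt) (by
      intro z hz x y
      rw [(hfd z hz).fderiv]
      have h := fun u : ℂ => (fderiv ℂ f z).map_smul u 1
      simp only [smul_eq_mul, mul_one] at h
      simp [h x, h y]
      ring)
  refine ⟨F, fun z hz => ?_⟩
  have := (hF z hz).hasDerivAt
  simpa [ω] using this

def nume (α : ℝ) (z : ℂ) : ℂ :=
  -(π * (1 + I * z) * Complex.sinh (π * z)) + I * (π * (1 - α) * Real.sin (π * α))
def eder (α : ℝ) (z : ℂ) : ℂ := dslope (nume α) (α * I) z / dk α z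

lemma nume_self (α : ℝ) : nume α (α * I) = 0 := by
  unfold nume
  rw [← mul_assoc (π:ℂ) (α:ℂ) I, Complex.sinh_mul_I]
  push_cast
  linear_combination (-(π:ℂ) * α * I * Complex.sin (π * α)) * I_sq

lemma eder_of_ne {α : ℝ} {z : ℂ} (hz : z ≠ α * I) : eder α z = nume α z / Dk α z := by
  unfold eder
  rw [dk_of_ne hz, dslope_of_ne _ hz, slope_def_field, nume_self, sub_zero,
    div_div_div_cancel_right₀ (sub_ne_zero.2 hz)]

lemma eder_diff {α : ℝ} (hα : α ∈ Ioo (0:ℝ) 1) : DifferentiableOn ℂ (eder α) (Sbig α) := by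
  have h1 : Differentiable ℂ (nume α) := by
    unfold nume
    fun_prop
  have h2 : DifferentiableOn ℂ (dslope (nume α) (α * I)) univ :=
    (Complex.differentiableOn_dslope univ_mem).2 h1.differentiableOn
  intro z hz
  exact ((h2.differentiableAt univ_mem).div (dk_diff α z) (dk_ne hα hz)).differentiableWithinAt

lemma eder_bound {α : ℝ} (hα : α ∈ Ioo (0:ℝ) 1) :
    ∃ C, 0 ≤ C ∧ ∀ z ∈ Ust α, ‖eder α z‖ ≤ C * (1 + ‖z‖) := by
  obtain ⟨C, hC⟩ := (cpt α).exists_bound_of_continuousOn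
    ((eder_diff hα).continuousOn.mono (cpt_sub hα))
  refine ⟨max C 0 + 3 * π, by positivity, fun z hz => ?_⟩
  have hn := norm_nonneg z
  have hpi := Real.pi_pos
  rcases le_total |z.re| 1 with h | h
  · have h1 := hC z (mem_cpt hz h)
    have h4 : C ≤ max C 0 := le_max_left _ _
    have h5 : 0 ≤ max C 0 := le_max_right _ _
    nlinarith
  · have hne : z ≠ α * I := by
      rintro rfl; simp at h; linarith
    have h1 := Dk_ge α z
    have h2 := sinh_ge h
    have h6 := norm_sinh_le (π * z)
    have h4 : |((π:ℂ) * z).re| = π * |z.re| := by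
      simp [abs_mul, abs_of_pos Real.pi_pos]
    rw [h4] at h6
    set s := Real.sinh (π * |z.re|)
    have h3 : (3:ℝ) ≤ Real.exp (2 * |z.re|) := by
      have := Real.add_one_le_exp (2 * |z.re|); linarith
    rw [eder_of_ne hne, norm_div, div_le_iff₀ (by linarith)]
    have h7 : ‖nume α z‖ ≤ π * (1 + ‖z‖) * (s + 1) + π := by
      unfold nume
      refine (norm_add_le _ _).trans ?_
      rw [norm_neg, norm_mul, norm_mul, norm_mul, norm_mul, norm_mul, norm_I, one_mul]
      have p1 : ‖(π:ℂ)‖ = π := by rw [Complex.norm_real, Real.norm_of_nonneg hpi.le]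
      have p2 : ‖(1:ℂ) + I * z‖ ≤ 1 + ‖z‖ := by
        refine (norm_add_le _ _).trans ?_; simp
      have p3 : ‖(1 - α : ℂ)‖ ≤ 1 := by
        rw [show (1 - α : ℂ) = ((1 - α : ℝ) : ℂ) by push_cast; ring, Complex.norm_real,
          Real.norm_of_nonneg (by linarith [hα.2])]
        linarith [hα.1]
      have p4 : ‖(Real.sin (π * α) : ℂ)‖ ≤ 1 := by
        rw [Complex.norm_real]; exact Real.abs_sin_le_one _
      rw [p1]
      apply add_le_add
      · gcongr
      · calc π * ‖(1 - α : ℂ)‖ * ‖(Real.sin (π * α) : ℂ)‖ ≤ π * 1 * 1 := by gcongr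
          _ = π := by ring
    refine h7.trans ?_
    have h8 : 0 ≤ max C 0 := le_max_right _ _
    have h9 : π * (1 + ‖z‖) * (s + 1) + π ≤ 3 * π * (1 + ‖z‖) * (s - 1) := by
      have : 3 ≤ s - 1 := by linarith
      have q : 0 ≤ π * (1 + ‖z‖) := by positivity
      have q2 : π ≤ π * (1 + ‖z‖) := by nlinarith
      nlinarith
    refine h9.trans ?_
    apply mul_le_mul _ h1 (by linarith) (by positivity)
    apply mul_le_mul_of_nonneg_right _ (by positivity)
    linarith

lemma eder_bot {α : ℝ} (hα : α ∈ Ioo (0:ℝ) 1) (x : ℝ) :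
    (eder α x).re = -(π * Real.sinh (π * x)) / (Real.cosh (π * x) - Real.cos (π * α)) := by
  rw [eder_of_ne]
  · have h : nume α x / Dk α x =
        ((-(π * Real.sinh (π * x)) / (Real.cosh (π * x) - Real.cos (π * α)) : ℝ) : ℂ) +
        (((-(π * x * Real.sinh (π * x)) + π * (1 - α) * Real.sin (π * α)) /
          (Real.cosh (π * x) - Real.cos (π * α)) : ℝ) : ℂ) * I := by
      unfold nume Dk
      push_cast
      ring
    rw [h]; simp only [add_re, ofReal_re, re_ofReal_mul, I_re, mul_zero, add_zero]
  · intro h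
    have := congrArg Complex.im h
    simp at this
    linarith [hα.1]

lemma eder_top {α : ℝ} (hα : α ∈ Ioo (0:ℝ) 1) (x : ℝ) : (eder α (x + I)).re = 0 := by
  rw [eder_of_ne]
  · have h1 : Complex.cosh (π * (x + I)) = - Complex.cosh (π * x) := by
      rw [mul_add, Complex.cosh_add]; simp [Complex.cosh_mul_I, Complex.sinh_mul_I]
    have h2 : Complex.sinh (π * (x + I)) = - Complex.sinh (π * x) := by
      rw [mul_add, Complex.sinh_add]; simp [Complex.cosh_mul_I, Complex.sinh_mul_I]
    have h : nume α (x + I) / Dk α (x + I) =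
        (((π * x * Real.sinh (π * x) + π * (1 - α) * Real.sin (π * α)) /
          (-Real.cosh (π * x) - Real.cos (π * α)) : ℝ) : ℂ) * I := by
      unfold nume Dk
      rw [h1, h2]
      push_cast
      rw [show I * ((x:ℂ) + I) = I * x - 1 by rw [mul_add, I_mul_I]; ring]
      ring
    rw [h]; simp only [re_ofReal_mul, I_re, mul_zero]
  · intro h
    have := congrArg Complex.im h
    simp at this
    linarith [hα.2]

lemma logP_deriv {α : ℝ} (hα : α ∈ Ioo (0:ℝ) 1) (x : ℝ) :
    HasDerivAt (fun x => Real.log (Pker α x))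
      (-(π * Real.sinh (π * x)) / (Real.cosh (π * x) - Real.cos (π * α))) x := by
  have hs := sin_pos' hα
  have hpos : ∀ x, 0 < Real.cosh (π * x) - Real.cos (π * α) := by
    intro x
    have := Pker_pos hα x
    unfold Pker at this
    have := (div_pos_iff_of_pos_left hs).1 this
    linarith
  have e : (fun x => Real.log (Pker α x)) = fun x => Real.log (Real.sin (π * α)) - Real.log 2 -
      Real.log (Real.cosh (π * x) - Real.cos (π * α)) := by
    funext x
    unfold Pker
    rw [Real.log_div hs.ne' (by have := hpos x; positivity), Real.log_mul two_ne_zero (hpos x).ne']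
    ring
  rw [e]
  have h1 : HasDerivAt (fun x : ℝ => π * x) (π * 1) x := (hasDerivAt_id x).const_mul _
  have h2 := ((h1.cosh.sub_const (Real.cos (π * α))).log (hpos x).ne').const_sub
    (Real.log (Real.sin (π * α)) - Real.log 2)
  refine h2.congr_deriv ?_
  ring

lemma const_of_hasDeriv_zero (f : ℝ → ℝ) (h : ∀ x, HasDerivAt f 0 x) (x : ℝ) : f x = f 0 :=
  is_const_of_deriv_eq_zero (fun x => (h x).differentiableAt) (fun x => (h x).deriv) x 0

lemma exists_e {α : ℝ} (hα : α ∈ Ioo (0:ℝ) 1) :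
    ∃ e : ℂ → ℂ, DifferentiableOn ℂ e (Ust α) ∧ (∃ C, ∀ z ∈ Ust α, ‖e z‖ ≤ C * (1 + ‖z‖^2)) ∧
      (∀ x : ℝ, (e x).re = Real.log (Pker α x)) ∧ (∀ x : ℝ, (e (x + I)).re = 0) := by
  obtain ⟨F, hF⟩ := exists_primitive (Sbig α) (convex_Sbig α) (isOpen_Sbig α) (eder α) (eder_diff hα)
  obtain ⟨C, hC0, hC⟩ := eder_bound hα
  have m0 : ∀ x : ℝ, (x:ℂ) ∈ Ust α := fun x => closed_sub_Ust hα _ (by simp) (by simp)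
  have m1 : ∀ x : ℝ, (x:ℂ) + I ∈ Ust α := fun x => closed_sub_Ust hα _ (by simp) (by simp)
  have mz : (0:ℂ) ∈ Ust α := by simpa using m0 0
  have hb : ∀ z ∈ Ust α, ‖F z‖ ≤ (‖F 0‖ + 2 * C) * (1 + ‖z‖^2) := by
    intro z hz
    have hcv : Convex ℝ (Ust α ∩ Metric.closedBall 0 ‖z‖) :=
      (convex_Ust α).inter (convex_closedBall _ _)
    have := Convex.norm_image_sub_le_of_norm_hasDerivWithin_le (f := F) (f' := eder α)
      (s := Ust α ∩ Metric.closedBall 0 ‖z‖) (C := C * (1 + ‖z‖)) (x := 0) (y := z)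
      (fun w hw => (hF w (Ust_sub hα hw.1)).hasDerivWithinAt)
      (fun w hw => (hC w hw.1).trans (by
        have : ‖w‖ ≤ ‖z‖ := by simpa using hw.2
        gcongr)) hcv ⟨mz, by simp⟩ ⟨hz, by simp⟩
    have h2 : ‖F z‖ ≤ ‖F 0‖ + ‖F z - F 0‖ := by
      calc ‖F z‖ = ‖F 0 + (F z - F 0)‖ := by congr 1; ring
        _ ≤ _ := norm_add_le _ _
    rw [sub_zero] at this
    have hn := norm_nonneg z
    have h3 : (1 + ‖z‖) * ‖z‖ ≤ 2 * (1 + ‖z‖^2) := by nlinarith [sq_nonneg (‖z‖ - 1)]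
    have h4 : C * ((1 + ‖z‖) * ‖z‖) ≤ C * (2 * (1 + ‖z‖^2)) := mul_le_mul_of_nonneg_left h3 hC0
    have h5 : ‖F 0‖ ≤ ‖F 0‖ * (1 + ‖z‖^2) := by
      have := norm_nonneg (F 0); nlinarith [sq_nonneg ‖z‖]
    nlinarith
  have hbot : ∀ x : ℝ, (F x).re - Real.log (Pker α x) = (F (0:ℝ)).re - Real.log (Pker α 0) := by
    apply const_of_hasDeriv_zero (fun x : ℝ => (F x).re - Real.log (Pker α x))
    intro x
    have h1 : HasDerivAt (fun x : ℝ => F x) (eder α x) x :=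
      (hF x (Ust_sub hα (m0 x))).comp_ofReal
    have h2 : HasDerivAt (fun x : ℝ => (F x).re) (eder α x).re x :=
      (Complex.reCLM.hasFDerivAt.comp_hasDerivAt x h1)
    refine (h2.sub (logP_deriv hα x)).congr_deriv ?_
    rw [eder_bot hα]; ring
  have htop : ∀ x : ℝ, (F (x + I)).re = (F ((0:ℝ) + I)).re := by
    apply const_of_hasDeriv_zero (fun x : ℝ => (F (x + I)).re)
    intro x
    have h0 : HasDerivAt (fun z : ℂ => F (z + I)) (eder α (x + I)) (x:ℂ) :=
      (hF (x + I) (Ust_sub hα (m1 x))).comp_add_const (x:ℂ) I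
    have h2 : HasDerivAt (fun x : ℝ => (F (x + I)).re) (eder α (x + I)).re x :=
      (Complex.reCLM.hasFDerivAt.comp_hasDerivAt x h0.comp_ofReal)
    rwa [eder_top hα] at h2
  set c0 : ℝ := (F (0:ℝ)).re - Real.log (Pker α 0)
  set c1 : ℝ := (F ((0:ℝ) + I)).re
  refine ⟨fun z => F z - c0 + (c1 - c0 : ℝ) * (I * z), ?_, ?_, ?_, ?_⟩
  · intro z hz
    exact (((hF z (Ust_sub hα hz)).differentiableAt.sub_const _).add
      ((differentiableAt_id.const_mul I).const_mul _)).differentiableWithinAt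
  · refine ⟨(‖F 0‖ + 2 * C) + |c0| + |c1 - c0|, fun z hz => ?_⟩
    have h1 := hb z hz
    have h2 : ‖F z - c0 + (c1 - c0 : ℝ) * (I * z)‖ ≤ ‖F z‖ + |c0| + |c1 - c0| * ‖z‖ := by
      refine (norm_add_le _ _).trans (add_le_add ((norm_sub_le _ _).trans ?_) ?_)
      · rw [Complex.norm_real]; rfl
      · rw [norm_mul, norm_mul, norm_I, one_mul, Complex.norm_real]; rfl
    refine h2.trans ?_
    have h3 : ‖z‖ ≤ 1 + ‖z‖^2 := by nlinarith [sq_nonneg (‖z‖ - 1), norm_nonneg z]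
    have h4 := mul_le_mul_of_nonneg_left h3 (abs_nonneg (c1 - c0))
    have h5 : |c0| ≤ |c0| * (1 + ‖z‖^2) := by
      have := abs_nonneg c0; nlinarith [sq_nonneg ‖z‖]
    linarith
  · intro x
    have := hbot x
    simp
    linarith
  · intro x
    have := htop x
    simp
    linarith

lemma e_value {α : ℝ} (hα : α ∈ Ioo (0:ℝ) 1) (e : ℂ → ℂ) (he : DifferentiableOn ℂ e (Ust α))
    (hC : ∃ C, ∀ z ∈ Ust α, ‖e z‖ ≤ C * (1 + ‖z‖^2))
    (h0 : ∀ x : ℝ, (e x).re = Real.log (Pker α x)) (h1 : ∀ x : ℝ, (e (x + I)).re = 0) :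
    Integrable (fun x => Pker α x * Real.log (Pker α x)) ∧
    (e (α * I)).re = ∫ x, Pker α x * Real.log (Pker α x) := by
  obtain ⟨C, hC⟩ := hC
  obtain ⟨i0, i1, h⟩ := poisson hα e he C hC
  have hi : Integrable (fun x => Pker α x * Real.log (Pker α x)) := by
    refine i0.re.congr (Eventually.of_forall fun x => ?_)
    simp [h0]
  refine ⟨hi, ?_⟩
  have h' := congrArg Complex.re h
  rw [Complex.add_re] at h'
  have f0 := integral_re i0
  have f1 := integral_re i1
  simp only [RCLike.re_eq_complex_re] at f0 f1
  rw [← f0, ← f1] at h'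
  rw [← h']
  simp [h0, h1]

/-- The exponent `Φ` of the extremal function. -/
lemma exists_Phi {α : ℝ} (hα : α ∈ Ioo (0:ℝ) 1) (s t : ℝ) :
    ∃ e : ℂ → ℂ, DifferentiableOn ℂ e (Ust α) ∧ (∃ C, ∀ z ∈ Ust α, ‖e z‖ ≤ C * (1 + ‖z‖^2)) ∧
      (∀ x : ℝ, (e x).re = s * Real.log (Pker α x)) ∧
      (∀ x : ℝ, (e (x + I)).re = t * Real.log (Pker (1 - α) x)) ∧
      (e (α * I)).re = s * (∫ x, Pker α x * Real.log (Pker α x)) +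
        t * (∫ x, Pker (1 - α) x * Real.log (Pker (1 - α) x)) := by
  have hα' : 1 - α ∈ Ioo (0:ℝ) 1 := ⟨by linarith [hα.2], by linarith [hα.1]⟩
  obtain ⟨e, d, ⟨C, b⟩, v0, v1⟩ := exists_e hα
  obtain ⟨e', d', ⟨C', b'⟩, v0', v1'⟩ := exists_e hα'
  have w := (e_value hα e d ⟨C, b⟩ v0 v1).2
  have w' := (e_value hα' e' d' ⟨C', b'⟩ v0' v1').2
  have hm : ∀ z ∈ Ust α, I - z ∈ Ust (1 - α) := by
    rintro z ⟨h1, h2⟩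
    constructor <;> simp <;> linarith
  have hPeven : ∀ x, Pker (1 - α) (-x) = Pker (1 - α) x := by
    intro x; unfold Pker; simp
  refine ⟨fun z => s * e z + t * e' (I - z), ?_, ?_, ?_, ?_, ?_⟩
  · refine (d.const_mul _).add (DifferentiableOn.const_mul ?_ _)
    exact d'.comp (by fun_prop) hm
  · refine ⟨|s| * |C| + |t| * (|C'| * 3), fun z hz => ?_⟩
    have h1 := b z hz
    have h2 := b' _ (hm z hz)
    have h3 : ‖I - z‖ ≤ 1 + ‖z‖ := by
      refine (norm_sub_le _ _).trans ?_; simp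
    have h4 : 1 + ‖I - z‖^2 ≤ 3 * (1 + ‖z‖^2) := by
      have : ‖I - z‖^2 ≤ (1 + ‖z‖)^2 := by gcongr
      nlinarith [sq_nonneg (‖z‖ - 1)]
    refine (norm_add_le _ _).trans ?_
    rw [norm_mul, norm_mul, Complex.norm_real, Complex.norm_real, Real.norm_eq_abs,
      Real.norm_eq_abs]
    have h5 : ‖e z‖ ≤ |C| * (1 + ‖z‖^2) := h1.trans (by gcongr; exact le_abs_self _)
    have h6 : ‖e' (I - z)‖ ≤ |C'| * (3 * (1 + ‖z‖^2)) := by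
      refine h2.trans ?_
      calc C' * (1 + ‖I - z‖^2) ≤ |C'| * (1 + ‖I - z‖^2) := by gcongr; exact le_abs_self _
        _ ≤ _ := by gcongr
    calc |s| * ‖e z‖ + |t| * ‖e' (I - z)‖ ≤ |s| * (|C| * (1 + ‖z‖^2)) +
        |t| * (|C'| * (3 * (1 + ‖z‖^2))) := by gcongr
      _ = _ := by ring
  · intro x
    have := v1' (-x)
    rw [show ((-x:ℝ):ℂ) + I = I - x by push_cast; ring] at this
    simp [v0, this]
  · intro x
    have := v0' (-x)
    rw [show ((-x:ℝ):ℂ) = I - (x + I) by push_cast; ring, hPeven] at this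
    simp only [add_re, re_ofReal_mul, v1, this]
    ring
  · rw [show ((1 - α : ℝ) : ℂ) * I = I - α * I by push_cast; ring] at w'
    simp only [add_re, re_ofReal_mul, w, w']

lemma re_pow_four (z : ℂ) : (z ^ 4).re = z.re ^ 4 - 6 * z.re ^ 2 * z.im ^ 2 + z.im ^ 4 := by
  have : z ^ 4 = z * z * (z * z) := by ring
  rw [this]
  simp only [mul_re, mul_im]
  ring

lemma damp {α : ℝ} (hα : α ∈ Ioo (0:ℝ) 1) (Ψ : ℂ → ℂ) (C : ℝ)
    (hΨ : ∀ z ∈ Ust α, ‖Ψ z‖ ≤ C * (1 + ‖z‖ ^ 2)) (ε : ℝ) (hε : 0 < ε) :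
    ∃ C', 0 ≤ C' ∧ ∀ z ∈ Ust α, ‖Complex.exp (Ψ z - ε * z ^ 4)‖ ≤ C' * Real.exp (-|z.re|) := by
  have hC : 0 ≤ C := by
    have h0 : (0:ℂ) ∈ Ust α := by
      apply closed_sub_Ust hα <;> simp
    have := (norm_nonneg _).trans (hΨ 0 h0)
    simpa using this
  set A := C + 24 * ε + 1 with hA
  refine ⟨Real.exp (5 * C + 1 + A ^ 2 / (4 * ε)), (Real.exp_pos _).le, fun z hz => ?_⟩
  rw [Complex.norm_exp, ← Real.exp_add, Real.exp_le_exp, sub_re, re_ofReal_mul, re_pow_four]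
  have h1 := (Complex.re_le_norm (Ψ z)).trans (hΨ z hz)
  have h2 : ‖z‖ ^ 2 = z.re ^ 2 + z.im ^ 2 := by
    rw [← Complex.normSq_eq_norm_sq, Complex.normSq_apply]; ring
  have h3 : z.im ^ 2 ≤ 4 := by
    have ha := hz.1
    have hb := hz.2
    have := hα.1
    have := hα.2
    nlinarith
  have h4 : |z.re| ≤ 1 + z.re ^ 2 := by
    rw [← sq_abs]; nlinarith [sq_nonneg (|z.re| - 1)]
  have h5 : A * z.re ^ 2 - ε * z.re ^ 4 ≤ A ^ 2 / (4 * ε) := by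
    rw [le_div_iff₀ (by positivity)]
    nlinarith [sq_nonneg (A - 2 * ε * z.re ^ 2)]
  have h6 : C * (1 + ‖z‖ ^ 2) ≤ C * (5 + z.re ^ 2) := by
    rw [h2]; apply mul_le_mul_of_nonneg_left _ hC; linarith
  have h7 : ε * (6 * z.re ^ 2 * z.im ^ 2) ≤ ε * (24 * z.re ^ 2) := by
    apply mul_le_mul_of_nonneg_left _ hε.le; nlinarith [mul_le_mul_of_nonneg_left h3 (sq_nonneg z.re)]
  have h8 : 0 ≤ ε * z.im ^ 4 := by positivity
  nlinarith

lemma memLp_exp_abs (r : ℝ≥0∞) (hr : 1 ≤ r) :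
    MemLp (fun x : ℝ => Real.exp (-|x|)) r volume := by
  have hm : AEStronglyMeasurable (fun x : ℝ => Real.exp (-|x|)) volume :=
    (by fun_prop : Continuous fun x : ℝ => Real.exp (-|x|)).aestronglyMeasurable
  by_cases hr' : r = ⊤
  · rw [hr']
    refine memLp_top_of_bound hm 1 (Eventually.of_forall fun x => ?_)
    rw [Real.norm_of_nonneg (Real.exp_pos _).le, Real.exp_le_one_iff]
    simp
  · have h0 : r ≠ 0 := by positivity
    rw [← integrable_norm_rpow_iff hm h0 hr']
    have h1 : 1 ≤ r.toReal := by
      rw [← ENNReal.toReal_one]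
      exact ENNReal.toReal_mono hr' hr
    refine integrable_exp_abs.mono' ?_ (Eventually.of_forall fun x => ?_)
    · exact (hm.norm.aemeasurable.pow_const _).aestronglyMeasurable
    · rw [Real.norm_of_nonneg (by positivity), Real.norm_of_nonneg (Real.exp_pos _).le,
        ← Real.exp_mul, Real.exp_le_exp]
      nlinarith [abs_nonneg x]

lemma hardy_weak {p q : ℝ≥0∞} {h : ℂ → ℂ} (hh : hardyNorm p q h < ⊤) :
    ∃ M : ℝ≥0∞, M < ⊤ ∧ ∀ y ∈ Ioo (0:ℝ) 1, ∃ f g : ℝ → ℂ, Measurable f ∧ Measurable g ∧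
      f + g = bLine h y ∧ eLpNorm f p volume ≤ M ∧ eLpNorm g q volume ≤ M := by
  refine ⟨hardyNorm p q h + 1, by simpa using hh, fun y hy => ?_⟩
  have h1 : (⨅ (f : ℝ → ℂ) (g : ℝ → ℂ) (_ : Measurable f) (_ : Measurable g)
      (_ : f + g = bLine h y),
      ENNReal.ofReal (1 - y)⁻¹ * eLpNorm f p volume +
        ENNReal.ofReal y⁻¹ * eLpNorm g q volume) < hardyNorm p q h + 1 := by
    refine lt_of_le_of_lt ?_ (ENNReal.lt_add_right hh.ne one_ne_zero)
    unfold hardyNorm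
    exact le_iSup₂ (f := fun (y : ℝ) (_ : y ∈ Ioo (0:ℝ) 1) =>
      ⨅ (f : ℝ → ℂ) (g : ℝ → ℂ) (_ : Measurable f) (_ : Measurable g)
      (_ : f + g = bLine h y),
      ENNReal.ofReal (1 - y)⁻¹ * eLpNorm f p volume +
        ENNReal.ofReal y⁻¹ * eLpNorm g q volume) y hy
  simp only [iInf_lt_iff] at h1
  obtain ⟨f, g, hf, hg, hfg, hlt⟩ := h1
  refine ⟨f, g, hf, hg, hfg, ?_, ?_⟩
  · refine le_trans ?_ (le_trans le_self_add hlt.le)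
    refine le_mul_of_one_le_left' ?_
    rw [← ENNReal.ofReal_one]
    apply ENNReal.ofReal_le_ofReal
    exact (one_le_inv₀ (by linarith [hy.2])).2 (by linarith [hy.1])
  · refine le_trans ?_ (le_trans le_add_self hlt.le)
    refine le_mul_of_one_le_left' ?_
    rw [← ENNReal.ofReal_one]
    apply ENNReal.ofReal_le_ofReal
    exact (one_le_inv₀ hy.1).2 hy.2.le

lemma holder_aux (p r : ℝ≥0∞) (hr2 : ENNReal.HolderTriple r p 1)
    {E : Type*} [NormedAddCommGroup E] [NormedSpace ℝ E]
    (f : ℝ → E) (hf : AEStronglyMeasurable f volume) (g : ℝ → ℝ)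
    (hg : AEStronglyMeasurable g volume) :
    eLpNorm (fun x => g x • f x) 1 volume ≤ eLpNorm g r volume * eLpNorm f p volume :=
  eLpNorm_smul_le_mul_eLpNorm hf hg

lemma exp_mul_bound (p : ℝ≥0∞) (hp : 1 ≤ p) : ∃ K : ℝ≥0∞, K < ⊤ ∧ ∀ f : ℝ → ℂ, Measurable f →
    eLpNorm (fun x => Real.exp (-|x|) • f x) 1 volume ≤ K * eLpNorm f p volume := by
  obtain ⟨r, hr⟩ : ∃ r, ENNReal.HolderConjugate p r :=
    ⟨_, ENNReal.HolderConjugate.conjExponent hp⟩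
  have hr1 : 1 ≤ r := by
    clear hp
    have := hr.symm
    exact ENNReal.HolderConjugate.one_le r p
  exact ⟨eLpNorm (fun x : ℝ => Real.exp (-|x|)) r volume, (memLp_exp_abs r hr1).2,
    fun f hf => holder_aux p r hr.symm f hf.aestronglyMeasurable (fun x : ℝ => Real.exp (-|x|))
      (by fun_prop : Continuous fun x : ℝ => Real.exp (-|x|)).aestronglyMeasurable⟩

lemma weak_int {p q : ℝ≥0∞} (hp : 1 ≤ p) (hq : 1 ≤ q) {h : ℂ → ℂ} (hh : hardyNorm p q h < ⊤) :
    ∃ C : ℝ, 0 ≤ C ∧ ∀ y ∈ Ioo (0:ℝ) 1,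
      Integrable (fun x : ℝ => ‖h (x + y * I)‖ * Real.exp (-|x|)) ∧
      ∫ x : ℝ, ‖h (x + y * I)‖ * Real.exp (-|x|) ≤ C := by
  obtain ⟨M, hM, H⟩ := hardy_weak hh
  obtain ⟨K, hK, HK⟩ := exp_mul_bound p hp
  obtain ⟨L, hL, HL⟩ := exp_mul_bound q hq
  have hfin : K * M + L * M < ⊤ := by
    rw [ENNReal.add_lt_top]; exact ⟨ENNReal.mul_lt_top hK hM, ENNReal.mul_lt_top hL hM⟩
  refine ⟨(K * M + L * M).toReal, ENNReal.toReal_nonneg, fun y hy => ?_⟩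
  obtain ⟨f, g, hf, hg, hfg, h1, h2⟩ := H y hy
  have hme : Measurable fun x : ℝ => Real.exp (-|x|) := by fun_prop
  have e1 : (fun x : ℝ => Real.exp (-|x|) • bLine h y x) =
      (fun x => Real.exp (-|x|) • f x) + (fun x => Real.exp (-|x|) • g x) := by
    rw [← hfg]; ext x; simp
  have hmeas : AEStronglyMeasurable (fun x : ℝ => Real.exp (-|x|) • bLine h y x) volume := by
    rw [e1]; exact ((hme.smul hf).add (hme.smul hg)).aestronglyMeasurable
  have h3 : eLpNorm (fun x : ℝ => Real.exp (-|x|) • bLine h y x) 1 volume ≤ K * M + L * M := by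
    rw [e1]
    refine (eLpNorm_add_le (hme.smul hf).aestronglyMeasurable
      (hme.smul hg).aestronglyMeasurable le_rfl).trans ?_
    gcongr
    · exact (HK f hf).trans (by gcongr)
    · exact (HL g hg).trans (by gcongr)
  have hi : Integrable (fun x : ℝ => Real.exp (-|x|) • bLine h y x) :=
    memLp_one_iff_integrable.1 ⟨hmeas, h3.trans_lt hfin⟩
  have e2 : (fun x : ℝ => ‖h (x + y * I)‖ * Real.exp (-|x|)) =
      fun x : ℝ => ‖Real.exp (-|x|) • bLine h y x‖ := by
    ext x
    rw [norm_smul, Real.norm_of_nonneg (Real.exp_pos _).le, mul_comm]; rfl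
  rw [e2]
  refine ⟨hi.norm, ?_⟩
  rw [integral_norm_eq_lintegral_enorm hmeas, ← eLpNorm_one_eq_lintegral_enorm]
  exact ENNReal.toReal_mono hfin.ne h3

def Vst (c δ : ℝ) : Set ℂ := {z | c - δ < z.im ∧ z.im < c + δ}

lemma isOpen_Vst (c δ : ℝ) : IsOpen (Vst c δ) :=
  (isOpen_lt continuous_const continuous_im).inter (isOpen_lt continuous_im continuous_const)

lemma closedBall_Vst {c δ r : ℝ} {z : ℂ} (h1 : |z.im - c| + r < δ) :
    Metric.closedBall z r ⊆ Vst c δ := by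
  intro w hw
  rw [Metric.mem_closedBall, dist_eq_norm] at hw
  have h2 := (Complex.abs_im_le_norm (w - z)).trans hw
  rw [sub_im] at h2
  have h3 := abs_le.1 h2
  have h4 := abs_le.1 (le_refl |z.im - c|)
  constructor <;> linarith [h4.1, h4.2, h3.1, h3.2]

lemma iter_diff {c δ : ℝ} {k : ℂ → ℂ} (hk : DifferentiableOn ℂ k (Vst c δ)) (n : ℕ) :
    DifferentiableOn ℂ (iteratedDeriv n k) (Vst c δ) := by
  induction n with
  | zero => simpa using hk
  | succ n ih => rw [iteratedDeriv_succ]; exact ih.deriv (isOpen_Vst c δ)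

lemma line_mem {c δ : ℝ} (hδ : 0 < δ) (x : ℝ) : ((x:ℂ) + c * I) ∈ Vst c δ := by
  constructor <;> simp <;> linarith

lemma line_deriv {c δ : ℝ} (hδ : 0 < δ) {k : ℂ → ℂ} (hk : DifferentiableOn ℂ k (Vst c δ)) (x : ℝ) :
    HasDerivAt (fun x : ℝ => k (x + c * I)) (deriv k (x + c * I)) x := by
  have h1 : HasDerivAt k (deriv k (x + c * I)) ((x:ℂ) + c * I) :=
    (hk.differentiableAt ((isOpen_Vst c δ).mem_nhds (line_mem hδ x))).hasDerivAt
  have h2 : HasDerivAt (fun x : ℂ => k (x + c * I)) (deriv k (x + c * I)) (x:ℂ) :=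
    h1.comp_add_const (x:ℂ) (c * I)
  exact h2.comp_ofReal

lemma iter_line {c δ : ℝ} (hδ : 0 < δ) {k : ℂ → ℂ} (hk : DifferentiableOn ℂ k (Vst c δ)) (n : ℕ) :
    iteratedDeriv n (fun x : ℝ => k (x + c * I)) = fun x : ℝ => iteratedDeriv n k (x + c * I) := by
  induction n with
  | zero => simp
  | succ n ih =>
    rw [iteratedDeriv_succ, ih, iteratedDeriv_succ]
    ext x
    exact (line_deriv hδ (iter_diff hk n) x).deriv

lemma sphere_bound {c δ C : ℝ} (hδ : 0 < δ) {k : ℂ → ℂ} (hC0 : 0 ≤ C)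
    (hC : ∀ z ∈ Vst c δ, ‖k z‖ ≤ C * Real.exp (-|z.re|)) {z : ℂ} (hz : |z.im - c| < δ / 2)
    {w : ℂ} (hw : w ∈ Metric.sphere z (δ / 2)) :
    ‖k w‖ ≤ C * Real.exp (δ / 2) * Real.exp (-|z.re|) := by
  have h1 : w ∈ Vst c δ :=
    closedBall_Vst (r := δ / 2) (by linarith) (Metric.sphere_subset_closedBall hw)
  refine (hC w h1).trans ?_
  rw [mul_assoc, ← Real.exp_add]
  apply mul_le_mul_of_nonneg_left _ hC0
  rw [Real.exp_le_exp]
  rw [Metric.mem_sphere, dist_eq_norm] at hw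
  have h2 := Complex.abs_re_le_norm (w - z)
  rw [hw, sub_re] at h2
  have h3 := abs_sub_abs_le_abs_sub z.re w.re
  rw [abs_sub_comm] at h3
  linarith

lemma diffcont {c δ : ℝ} {k : ℂ → ℂ} (hδ : 0 < δ) (hk : DifferentiableOn ℂ k (Vst c δ))
    {z : ℂ} (hz : |z.im - c| < δ / 2) : DiffContOnCl ℂ k (Metric.ball z (δ / 2)) := by
  apply DifferentiableOn.diffContOnCl
  apply hk.mono
  exact (Metric.closure_ball_subset_closedBall).trans (closedBall_Vst (by linarith))

lemma schwartz_line {c δ C : ℝ} (hδ : 0 < δ) {k : ℂ → ℂ} (hk : DifferentiableOn ℂ k (Vst c δ))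
    (hC0 : 0 ≤ C) (hC : ∀ z ∈ Vst c δ, ‖k z‖ ≤ C * Real.exp (-|z.re|)) :
    ∃ φ : SchwartzMap ℝ ℂ, ∀ x : ℝ, φ x = k (x + c * I) := by
  refine ⟨⟨fun x : ℝ => k (x + c * I), ?_, ?_⟩, fun x => rfl⟩
  · apply contDiff_of_differentiable_iteratedDeriv (n := ⊤)
    intro m _ x
    rw [iter_line hδ hk]
    exact (line_deriv hδ (iter_diff hk m) x).differentiableAt
  · intro m n
    refine ⟨m.factorial * (n.factorial * (C * Real.exp (δ / 2)) / (δ / 2) ^ n), fun x => ?_⟩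
    rw [norm_iteratedFDeriv_eq_norm_iteratedDeriv, iter_line hδ hk]
    have hz : |((x:ℂ) + c * I).im - c| < δ / 2 := by simp; linarith
    have h1 := Complex.norm_iteratedDeriv_le_of_forall_mem_sphere_norm_le n (half_pos hδ)
      (diffcont hδ hk hz) (fun w hw => sphere_bound hδ hC0 hC hz hw)
    have h2 : ‖x‖ ^ m ≤ m.factorial * Real.exp |x| := by
      have := Real.pow_div_factorial_le_exp |x| (abs_nonneg x) m
      rw [div_le_iff₀ (by positivity)] at this
      rw [Real.norm_eq_abs]; linarith
    have h3 : (((x:ℂ) + c * I).re) = x := by simp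
    rw [h3] at h1
    calc ‖x‖ ^ m * ‖iteratedDeriv n k (x + c * I)‖ ≤ (m.factorial * Real.exp |x|) *
          (n.factorial * (C * Real.exp (δ / 2) * Real.exp (-|x|)) / (δ / 2) ^ n) := by
          gcongr
      _ = m.factorial * (n.factorial * (C * Real.exp (δ / 2)) / (δ / 2) ^ n) *
          (Real.exp |x| * Real.exp (-|x|)) := by ring
      _ = _ := by rw [← Real.exp_add]; simp

lemma kernel_lip {c δ C : ℝ} (hδ : 0 < δ) {k : ℂ → ℂ} (hk : DifferentiableOn ℂ k (Vst c δ))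
    (hC0 : 0 ≤ C) (hC : ∀ z ∈ Vst c δ, ‖k z‖ ≤ C * Real.exp (-|z.re|))
    (x y : ℝ) (hy : |y - c| < δ / 2) :
    ‖k (x + y * I) - k (x + c * I)‖ ≤ C * Real.exp (δ / 2) / (δ / 2) * |y - c| * Real.exp (-|x|) := by
  have hd : ∀ z ∈ {z : ℂ | z.re = x} ∩ Vst c (δ / 2),
      ‖deriv k z‖ ≤ C * Real.exp (δ / 2) * Real.exp (-|x|) / (δ / 2) := by
    rintro z ⟨hz1, hz2⟩
    have hz : |z.im - c| < δ / 2 := by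
      rw [abs_lt]; constructor <;> linarith [hz2.1, hz2.2]
    have hz1 : z.re = x := hz1
    rw [← hz1]
    exact Complex.norm_deriv_le_of_forall_mem_sphere_norm_le (half_pos hδ)
      (diffcont hδ hk hz) (fun w hw => sphere_bound hδ hC0 hC hz hw)
  have hconv : Convex ℝ ({z : ℂ | z.re = x} ∩ Vst c (δ / 2)) := by
    apply Convex.inter
    · exact convex_hyperplane (f := Complex.re) Complex.reCLM.isLinear x
    · exact (convex_halfSpace_im_gt _).inter (convex_halfSpace_im_lt _)
  have hsub : ({z : ℂ | z.re = x} ∩ Vst c (δ / 2)) ⊆ Vst c δ := by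
    rintro z ⟨_, hz⟩; constructor <;> linarith [hz.1, hz.2]
  have h := hconv.norm_image_sub_le_of_norm_hasDerivWithin_le (f := k) (f' := deriv k)
    (C := C * Real.exp (δ / 2) * Real.exp (-|x|) / (δ / 2))
    (x := x + c * I) (y := x + y * I)
    (fun z hz => ((hk.differentiableAt
      ((isOpen_Vst c δ).mem_nhds (hsub hz))).hasDerivAt).hasDerivWithinAt) hd
    ⟨by simp, line_mem (half_pos hδ) x⟩
    ⟨by simp, by
      have := abs_lt.1 hy
      constructor <;> simp <;> linarith [this.1, this.2]⟩
  refine h.trans (le_of_eq ?_)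
  have : ‖(x + y * I : ℂ) - (x + c * I)‖ = |y - c| := by
    rw [show (x + y * I : ℂ) - (x + c * I) = ((y - c : ℝ) : ℂ) * I by push_cast; ring]
    rw [norm_mul, Complex.norm_I, Complex.norm_real, mul_one, Real.norm_eq_abs]
  rw [this]; ring

lemma line_cont {h : ℂ → ℂ} (hh : DifferentiableOn ℂ h Strip) {y : ℝ} (hy : y ∈ Ioo (0:ℝ) 1) :
    Continuous fun x : ℝ => h (x + y * I) := by
  apply hh.continuousOn.comp_continuous (by fun_prop)
  intro x
  constructor <;> simp [hy.1, hy.2]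

lemma line_cont' {c δ : ℝ} {k : ℂ → ℂ} (hk : DifferentiableOn ℂ k (Vst c δ)) {y : ℝ}
    (hy : |y - c| < δ) : Continuous fun x : ℝ => k (x + y * I) := by
  apply hk.continuousOn.comp_continuous (by fun_prop)
  intro x
  have := abs_lt.1 hy
  constructor <;> simp <;> linarith [this.1, this.2]

lemma moving {c δ C Cw : ℝ} (hδ : 0 < δ) {k : ℂ → ℂ} (hk : DifferentiableOn ℂ k (Vst c δ))
    (hC0 : 0 ≤ C) (hC : ∀ z ∈ Vst c δ, ‖k z‖ ≤ C * Real.exp (-|z.re|))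
    {h : ℂ → ℂ} (hh : DifferentiableOn ℂ h Strip)
    (hw : ∀ y ∈ Ioo (0:ℝ) 1,
      Integrable (fun x : ℝ => ‖h (x + y * I)‖ * Real.exp (-|x|)) ∧
      ∫ x : ℝ, ‖h (x + y * I)‖ * Real.exp (-|x|) ≤ Cw)
    (l : Filter ℝ) (hl : l ≤ 𝓝 c) (hl' : ∀ᶠ y in l, y ∈ Ioo (0:ℝ) 1) (v : ℝ → ℂ)
    (ht : ∀ φ : SchwartzMap ℝ ℂ,
      Tendsto (fun y : ℝ => ∫ x : ℝ, h (x + y * Complex.I) * (starRingEnd ℂ) (φ x))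
      l (𝓝 (∫ x : ℝ, v x * (starRingEnd ℂ) (φ x)))) :
    Tendsto (fun y : ℝ => ∫ x : ℝ, h (x + y * I) * k (x + y * I)) l
      (𝓝 (∫ x : ℝ, v x * k (x + c * I))) := by
  obtain ⟨φ, hφ⟩ := schwartz_line hδ hk hC0 hC
  have h1 := ht (φ.postcompCLM (Complex.conjCLE : ℂ →L[ℝ] ℂ))
  have e : ∀ x, (starRingEnd ℂ) (φ.postcompCLM (Complex.conjCLE : ℂ →L[ℝ] ℂ) x) =
      k (x + c * I) := by
    intro x; rw [SchwartzMap.postcompCLM_apply, ← hφ]; simp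
  simp only [e] at h1
  refine tendsto_of_tendsto_of_dist h1 ?_
  have hy0 : Tendsto (fun y : ℝ => C * Real.exp (δ / 2) / (δ / 2) * |y - c| * Cw) l (𝓝 0) := by
    have : Continuous fun y : ℝ => C * Real.exp (δ / 2) / (δ / 2) * |y - c| * Cw := by fun_prop
    have h2 := (this.tendsto c).mono_left hl
    simpa using h2
  refine squeeze_zero' (Eventually.of_forall fun _ => dist_nonneg) ?_ hy0
  have hb : ∀ᶠ y in l, |y - c| < δ / 2 := by
    apply hl
    have := Metric.ball_mem_nhds c (half_pos hδ)
    filter_upwards [this] with y hy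
    simpa [Real.dist_eq] using hy
  filter_upwards [hb, hl'] with y hy hy1
  have hcu := line_cont hh hy1
  have hcy := line_cont' hk (y := y) (by linarith)
  have hcc := line_cont' hk (y := c) (by simpa using hδ)
  have hyV : ∀ x : ℝ, ((x:ℂ) + y * I) ∈ Vst c δ := by
    intro x
    have := abs_lt.1 hy
    constructor <;> simp <;> linarith [this.1, this.2]
  have hi1 : Integrable fun x : ℝ => h (x + y * I) * k (x + c * I) := by
    refine ((hw y hy1).1.const_mul C).mono' (hcu.mul hcc).aestronglyMeasurable
      (Eventually.of_forall fun x => ?_)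
    have := hC _ (line_mem (c := c) hδ x)
    simp at this
    rw [norm_mul]
    nlinarith [norm_nonneg (h (x + y * I))]
  have hi2 : Integrable fun x : ℝ => h (x + y * I) * k (x + y * I) := by
    refine ((hw y hy1).1.const_mul C).mono' (hcu.mul hcy).aestronglyMeasurable
      (Eventually.of_forall fun x => ?_)
    have := hC _ (hyV x)
    simp at this
    rw [norm_mul]
    nlinarith [norm_nonneg (h (x + y * I))]
  rw [dist_comm, dist_eq_norm, ← integral_sub hi2 hi1]
  calc ‖∫ x : ℝ, (h (x + y * I) * k (x + y * I) - h (x + y * I) * k (x + c * I))‖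
      ≤ ∫ x : ℝ, (C * Real.exp (δ / 2) / (δ / 2) * |y - c|) *
          (‖h (x + y * I)‖ * Real.exp (-|x|)) := by
        apply norm_integral_le_of_norm_le ((hw y hy1).1.const_mul _)
        refine Eventually.of_forall fun x => ?_
        rw [← mul_sub, norm_mul]
        have := kernel_lip hδ hk hC0 hC x y hy
        nlinarith [norm_nonneg (h (x + y * I))]
    _ ≤ _ := by
        rw [integral_const_mul]
        apply mul_le_mul_of_nonneg_left (hw y hy1).2
        positivity

lemma Vst0_sub {α : ℝ} (hα : α ∈ Ioo (0:ℝ) 1) : Vst 0 (α / 4) ⊆ Ust α := by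
  intro z hz
  have h1 := hz.1
  have h2 := hz.2
  have := hα.1
  have := hα.2
  constructor <;> linarith

lemma Vst1_sub {α : ℝ} (hα : α ∈ Ioo (0:ℝ) 1) : Vst 1 ((1 - α) / 4) ⊆ Ust α := by
  intro z hz
  have h1 := hz.1
  have h2 := hz.2
  have := hα.1
  have := hα.2
  constructor <;> linarith

/-- common facts on the kernel `mker α z * X z / (z - α I)` away from the pole -/
lemma ker_facts {α : ℝ} (hα : α ∈ Ioo (0:ℝ) 1) {X : ℂ → ℂ} (hX : DifferentiableOn ℂ X (Ust α))
    {CX Cm : ℝ} (hCX0 : 0 ≤ CX) (hCX : ∀ z ∈ Ust α, ‖X z‖ ≤ CX) (hCm0 : 0 ≤ Cm)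
    (hCm : ∀ z ∈ Ust α, ‖mker α z‖ ≤ Cm * Real.exp (-|z.re|))
    (V : Set ℂ) (hV : V ⊆ Ust α) (d : ℝ) (hd : 0 < d) (hpole : ∀ z ∈ V, d ≤ |z.im - α|) :
    DifferentiableOn ℂ (fun z => mker α z * X z / (z - α * I)) V ∧
    ∀ z ∈ V, ‖mker α z * X z / (z - α * I)‖ ≤ Cm * CX / d * Real.exp (-|z.re|) := by
  have hn : ∀ z ∈ V, d ≤ ‖z - α * I‖ := by
    intro z hz
    refine (hpole z hz).trans ?_
    have := Complex.abs_im_le_norm (z - α * I)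
    simpa using this
  constructor
  · apply DifferentiableOn.div
    · exact ((mk_diff hα).mono (hV.trans (Ust_sub hα))).mul (hX.mono hV)
    · fun_prop
    · intro z hz h0
      have := hn z hz
      rw [h0, norm_zero] at this
      linarith
  · intro z hz
    rw [norm_div, norm_mul]
    calc ‖mker α z‖ * ‖X z‖ / ‖z - α * I‖ ≤ (Cm * Real.exp (-|z.re|)) * CX / d := by
          gcongr
          · exact hCm z (hV hz)
          · exact hCX z (hV hz)
          · exact hn z hz
      _ = _ := by ring

lemma key {α : ℝ} (hα : α ∈ Ioo (0:ℝ) 1) {h : ℂ → ℂ} (hh : DifferentiableOn ℂ h Strip) {Cw : ℝ}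
    (hw : ∀ y ∈ Ioo (0:ℝ) 1,
      Integrable (fun x : ℝ => ‖h (x + y * I)‖ * Real.exp (-|x|)) ∧
      ∫ x : ℝ, ‖h (x + y * I)‖ * Real.exp (-|x|) ≤ Cw)
    {h0 h1 : ℝ → ℂ} (ht0 : IsTrace0 h h0) (ht1 : IsTrace1 h h1)
    {X : ℂ → ℂ} (hX : DifferentiableOn ℂ X (Ust α))
    {CX : ℝ} (hCX0 : 0 ≤ CX) (hCX : ∀ z ∈ Ust α, ‖X z‖ ≤ CX) :
    h (α * I) * X (α * I) = (∫ x : ℝ, h0 x * (Pker α x * X x)) +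
      ∫ x : ℝ, h1 x * (Pker (1 - α) x * X (x + I)) := by
  obtain ⟨Cm, hCm0, hCm⟩ := mk_bound hα
  have hα0 := hα.1
  have hα1 := hα.2
  set k : ℂ → ℂ := fun z => mker α z * X z / (z - α * I) with hkdef
  have kf0 := ker_facts hα hX hCX0 hCX hCm0 hCm _ (Vst0_sub hα) (α / 4) (by linarith) (by
    intro z hz
    have h1 := hz.1
    have h2 := hz.2
    rw [abs_sub_comm]
    refine le_trans ?_ (le_abs_self _)
    linarith)
  have kf1 := ker_facts hα hX hCX0 hCX hCm0 hCm _ (Vst1_sub hα) ((1 - α) / 4) (by linarith) (by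
    intro z hz
    have h1 := hz.1
    have h2 := hz.2
    refine le_trans ?_ (le_abs_self _)
    linarith)
  have m0 := moving (c := 0) (δ := α / 4) (by linarith) kf0.1 (by positivity) kf0.2 hh hw
    (𝓝[>] (0:ℝ)) nhdsWithin_le_nhds (Ioo_mem_nhdsGT one_pos) h0 ht0
  have m1 := moving (c := 1) (δ := (1 - α) / 4) (by linarith) kf1.1
    (div_nonneg (mul_nonneg hCm0 hCX0) (by linarith)) kf1.2 hh hw
    (𝓝[<] (1:ℝ)) nhdsWithin_le_nhds (Ioo_mem_nhdsLT one_pos) h1 ht1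
  have hflip : Tendsto (fun y : ℝ => 1 - y) (𝓝[>] (0:ℝ)) (𝓝[<] (1:ℝ)) := by
    apply tendsto_nhdsWithin_of_tendsto_nhds_of_eventually_within
    · have : Continuous fun y : ℝ => 1 - y := by fun_prop
      have h2 := this.tendsto 0
      rw [sub_zero] at h2
      exact h2.mono_left nhdsWithin_le_nhds
    · filter_upwards [self_mem_nhdsWithin] with y hy
      have : 0 < y := hy
      show 1 - y < 1
      linarith
  have m2 := m0.sub (m1.comp hflip)
  have hN : DifferentiableOn ℂ (fun z => h z * mker α z * X z) Strip := by
    have hs : Strip ⊆ Ust α := fun z hz => closed_sub_Ust hα z hz.1.le hz.2.le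
    exact (hh.mul ((mk_diff hα).mono (hs.trans (Ust_sub hα)))).mul (hX.mono hs)
  have hev : ∀ᶠ y : ℝ in 𝓝[>] (0:ℝ),
      (∫ x : ℝ, h (x + y * I) * k (x + y * I)) -
        (∫ x : ℝ, h (x + ((1 - y : ℝ) : ℂ) * I) * k (x + ((1 - y : ℝ):ℂ) * I)) =
      2 * π * I * (h (α * I) * mker α (α * I) * X (α * I)) := by
    have hm : 0 < min α (1 - α) := lt_min hα0 (by linarith)
    filter_upwards [Ioo_mem_nhdsGT hm] with y hy
    have hy1 : y < α := hy.2.trans_le (min_le_left _ _)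
    have hy2 : y < 1 - α := hy.2.trans_le (min_le_right _ _)
    have hbd : ∀ y' ∈ Icc y (1 - y), ∀ x : ℝ,
        ‖h (x + y' * I) * mker α (x + y' * I) * X (x + y' * I)‖ ≤
        Cm * CX * (‖h (x + y' * I)‖ * Real.exp (-|x|)) := by
      intro y' hy' x
      have hU : ((x:ℂ) + y' * I) ∈ Ust α := by
        apply closed_sub_Ust hα <;> simp <;> linarith [hy'.1, hy'.2, hy.1]
      have e1 := hCm _ hU
      have e2 := hCX _ hU
      simp at e1
      rw [norm_mul, norm_mul]
      calc ‖h (x + y' * I)‖ * ‖mker α (x + y' * I)‖ * ‖X (x + y' * I)‖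
          ≤ ‖h (x + y' * I)‖ * (Cm * Real.exp (-|x|)) * CX := by gcongr
        _ = _ := by ring
    have hy'm : ∀ y' ∈ Icc y (1 - y), y' ∈ Ioo (0:ℝ) 1 := fun y' hy' =>
      ⟨by linarith [hy.1, hy'.1], by linarith [hy.1, hy'.2]⟩
    have hInteg : ∀ y' ∈ Icc y (1 - y), Integrable fun x : ℝ =>
        h (x + y' * I) * mker α (x + y' * I) * X (x + y' * I) := by
      intro y' hy'
      refine ((hw y' (hy'm y' hy')).1.const_mul (Cm * CX)).mono' ?_
        (Eventually.of_forall (hbd y' hy'))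
      exact (line_cont hN (hy'm y' hy')).aestronglyMeasurable
    have := cauchy_strip y (1 - y) α hy1 (by linarith) Strip
      ((isOpen_lt continuous_const continuous_im).inter
        (isOpen_lt continuous_im continuous_const))
      (fun z h1 h2 => ⟨by linarith [hy.1], by linarith [hy.1]⟩)
      (fun z => h z * mker α z * X z) hN (Cm * CX * Cw) hInteg
      (by
        intro y' hy'
        calc ∫ x : ℝ, ‖h (x + y' * I) * mker α (x + y' * I) * X (x + y' * I)‖
            ≤ ∫ x : ℝ, Cm * CX * (‖h (x + y' * I)‖ * Real.exp (-|x|)) :=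
              integral_mono (hInteg y' hy').norm ((hw y' (hy'm y' hy')).1.const_mul (Cm * CX))
                (hbd y' hy')
          _ ≤ _ := by
              rw [integral_const_mul]
              exact mul_le_mul_of_nonneg_left (hw y' (hy'm y' hy')).2 (by positivity))
    rw [← this]
    simp only [hkdef]
    congr 1 <;> congr 1 <;> ext x <;> ring
  have m3 := tendsto_nhds_unique (m2.congr' hev) tendsto_const_nhds
  have e0 : (fun x : ℝ => h0 x * k (x + (0:ℝ) * I)) = fun x : ℝ => h0 x * (Pker α x * X x) := by
    ext x
    rw [← mk_bot hα x]
    simp only [hkdef]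
    have : (x:ℂ) + (0:ℝ) * I = x := by simp
    rw [this]; ring
  have e1 : (fun x : ℝ => h1 x * k (x + (1:ℝ) * I)) =
      fun x : ℝ => -(h1 x * (Pker (1 - α) x * X (x + I))) := by
    ext x
    have h3 := mk_top hα x
    have h4 : (Pker (1 - α) x : ℂ) = - (mker α (x + (1:ℝ) * I) / (x + (1:ℝ) * I - α * I)) := by
      rw [h3]; ring
    rw [h4]
    simp only [hkdef]
    have : (x:ℂ) + (1:ℝ) * I = x + I := by simp
    rw [this]; ring
  have hk0 : ∀ z, mker α z * X z / (z - α * I) = k z := fun z => rfl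
  simp only [hk0] at m3
  rw [e0, e1, integral_neg, sub_neg_eq_add] at m3
  rw [m3.symm.symm]
  have := mk_self hα
  linear_combination (-(h (α * I) * X (α * I))) * this

lemma Pker_eLp {α : ℝ} (hα : α ∈ Ioo (0:ℝ) 1) (r : ℝ≥0∞) (hr : 1 ≤ r) :
    eLpNorm (fun x => Pker α x ^ (r⁻¹).toReal) r volume =
      ENNReal.ofReal ((1 - α) ^ (r⁻¹).toReal) := by
  by_cases hr' : r = ⊤
  · subst hr'
    simp
    rw [eLpNormEssSup_const _ (NeZero.ne _)]
    simp
  · have h0 : r ≠ 0 := by positivity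
    have hpos : 0 < r.toReal := ENNReal.toReal_pos h0 hr'
    rw [eLpNorm_eq_lintegral_rpow_enorm_toReal h0 hr']
    have e1 : ∀ x, ‖Pker α x ^ (r⁻¹).toReal‖ₑ ^ r.toReal = ENNReal.ofReal (Pker α x) := by
      intro x
      have hP := Pker_pos hα x
      rw [Real.enorm_of_nonneg (by positivity), ENNReal.ofReal_rpow_of_nonneg (by positivity) hpos.le,
        ← Real.rpow_mul hP.le, ENNReal.toReal_inv, inv_mul_cancel₀ hpos.ne', Real.rpow_one]
    simp only [e1]
    obtain ⟨hi, hv⟩ := Pker_integral hα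
    rw [← ofReal_integral_eq_lintegral_ofReal hi (Eventually.of_forall fun x => (Pker_pos hα x).le),
      hv, ENNReal.ofReal_rpow_of_nonneg (by linarith [hα.2]) (by positivity), ENNReal.toReal_inv,
      one_div]

lemma holder_P {α : ℝ} (hα : α ∈ Ioo (0:ℝ) 1) (p : ℝ≥0∞) (hp : 1 ≤ p) (v w : ℝ → ℂ)
    (hv : MemLp v p volume) (K : ℝ) (hK : 0 ≤ K)
    (hw : ∀ x, ‖w x‖ ≤ K * Pker α x ^ (1 - (p⁻¹).toReal)) :
    ‖∫ x, v x * w x‖ ≤ K * ((1 - α) ^ (1 - (p⁻¹).toReal) * (eLpNorm v p volume).toReal) := by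
  obtain ⟨r, hr⟩ : ∃ r, ENNReal.HolderConjugate p r :=
    ⟨_, ENNReal.HolderConjugate.conjExponent hp⟩
  have hr1 : 1 ≤ r := by
    have := hr.symm
    exact ENNReal.HolderConjugate.one_le r p
  have hs : 1 - (p⁻¹).toReal = (r⁻¹).toReal := by
    have h1 := hr.inv_add_inv_eq_inv
    rw [inv_one] at h1
    have h2 := congrArg ENNReal.toReal h1
    rw [ENNReal.toReal_add (by simp; exact (one_pos.trans_le hp).ne')
      (by simp; exact (one_pos.trans_le hr1).ne'), ENNReal.toReal_one] at h2
    linarith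
  rw [hs] at hw ⊢
  have hPm : AEStronglyMeasurable (fun x => Pker α x ^ (r⁻¹).toReal) volume :=
    ((Pker_cont hα).rpow_const (fun x => Or.inl (Pker_pos hα x).ne')).aestronglyMeasurable
  have H := holder_aux p r hr.symm v hv.1 (fun x => Pker α x ^ (r⁻¹).toReal) hPm
  rw [Pker_eLp hα r hr1] at H
  have hfin : ENNReal.ofReal ((1 - α) ^ (r⁻¹).toReal) * eLpNorm v p volume ≠ ⊤ :=
    (ENNReal.mul_lt_top ENNReal.ofReal_lt_top hv.2).ne
  have hi : Integrable (fun x => Pker α x ^ (r⁻¹).toReal • v x) :=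
    memLp_one_iff_integrable.1 ⟨hPm.smul hv.1, H.trans_lt hfin.lt_top⟩
  calc ‖∫ x, v x * w x‖ ≤ ∫ x, K * ‖Pker α x ^ (r⁻¹).toReal • v x‖ := by
        apply norm_integral_le_of_norm_le (hi.norm.const_mul K)
        refine Eventually.of_forall fun x => ?_
        have hP := Pker_pos hα x
        rw [norm_mul, norm_smul, Real.norm_of_nonneg (by positivity)]
        nlinarith [hw x, norm_nonneg (v x)]
    _ = K * ∫ x, ‖Pker α x ^ (r⁻¹).toReal • v x‖ := integral_const_mul _ _
    _ ≤ _ := by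
        apply mul_le_mul_of_nonneg_left _ hK
        rw [integral_norm_eq_lintegral_enorm hi.1, ← eLpNorm_one_eq_lintegral_enorm]
        refine (ENNReal.toReal_mono hfin H).trans (le_of_eq ?_)
        rw [ENNReal.toReal_mul, ENNReal.toReal_ofReal]
        have := hα.2
        apply Real.rpow_nonneg; linarith

lemma re_top_four (x : ℝ) : -8 ≤ (((x:ℂ) + I) ^ 4).re := by
  rw [re_pow_four]
  simp
  nlinarith [sq_nonneg (x ^ 2 - 3)]

lemma one_sub_mem {α : ℝ} (hα : α ∈ Ioo (0:ℝ) 1) : 1 - α ∈ Ioo (0:ℝ) 1 :=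
  ⟨by linarith [hα.2], by linarith [hα.1]⟩

/-- The bundle of properties of the extremal exponent -/
structure IsPhi (α s t : ℝ) (Φ : ℂ → ℂ) : Prop where
  diff : DifferentiableOn ℂ Φ (Ust α)
  bd : ∃ C, ∀ z ∈ Ust α, ‖Φ z‖ ≤ C * (1 + ‖z‖ ^ 2)
  bot : ∀ x : ℝ, (Φ x).re = s * Real.log (Pker α x)
  top : ∀ x : ℝ, (Φ (x + I)).re = t * Real.log (Pker (1 - α) x)

lemma upper_eps {α : ℝ} (hα : α ∈ Ioo (0:ℝ) 1) {h : ℂ → ℂ} (hh : DifferentiableOn ℂ h Strip)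
    {Cw : ℝ}
    (hw : ∀ y ∈ Ioo (0:ℝ) 1,
      Integrable (fun x : ℝ => ‖h (x + y * I)‖ * Real.exp (-|x|)) ∧
      ∫ x : ℝ, ‖h (x + y * I)‖ * Real.exp (-|x|) ≤ Cw)
    {h0 h1 : ℝ → ℂ} (ht0 : IsTrace0 h h0) (ht1 : IsTrace1 h h1)
    {p q : ℝ≥0∞} (hp : 1 ≤ p) (hq : 1 ≤ q) (hm0 : MemLp h0 p volume) (hm1 : MemLp h1 q volume)
    {Φ : ℂ → ℂ} (hΦ : IsPhi α (p⁻¹).toReal (q⁻¹).toReal Φ) (l ε : ℝ) (hε : 0 < ε) :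
    ‖h (α * I)‖ * Real.exp (-(Φ (α * I)).re - l * α - ε * α ^ 4) ≤
      (1 - α) ^ (1 - (p⁻¹).toReal) * (eLpNorm h0 p volume).toReal +
      Real.exp (-l + 8 * ε) * (α ^ (1 - (q⁻¹).toReal) * (eLpNorm h1 q volume).toReal) := by
  obtain ⟨C, hC⟩ := hΦ.bd
  set Ψ : ℂ → ℂ := fun z => -Φ z + I * l * z with hΨ
  have hΨb : ∀ z ∈ Ust α, ‖Ψ z‖ ≤ (C + |l|) * (1 + ‖z‖ ^ 2) := by
    intro z hz
    have h1 := hC z hz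
    have h2 : ‖Ψ z‖ ≤ ‖Φ z‖ + |l| * ‖z‖ := by
      refine (norm_add_le _ _).trans (le_of_eq ?_)
      rw [norm_neg, norm_mul, norm_mul, Complex.norm_I, one_mul, Complex.norm_real,
        Real.norm_eq_abs]
    have h3 : ‖z‖ ≤ 1 + ‖z‖ ^ 2 := by nlinarith [sq_nonneg (‖z‖ - 1)]
    have h4 : |l| * ‖z‖ ≤ |l| * (1 + ‖z‖ ^ 2) := mul_le_mul_of_nonneg_left h3 (abs_nonneg l)
    linarith
  obtain ⟨CX, hCX0, hCX⟩ := damp hα Ψ _ hΨb ε hε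
  have hCX' : ∀ z ∈ Ust α, ‖Complex.exp (Ψ z - ε * z ^ 4)‖ ≤ CX := by
    intro z hz
    refine (hCX z hz).trans ?_
    have : Real.exp (-|z.re|) ≤ 1 := by rw [Real.exp_le_one_iff]; simp
    nlinarith
  have hXd : DifferentiableOn ℂ (fun z => Complex.exp (Ψ z - ε * z ^ 4)) (Ust α) := by
    have := hΦ.diff
    fun_prop
  have K := key hα hh hw ht0 ht1 hXd hCX0 hCX'
  have hl : ‖h (α * I)‖ * Real.exp (-(Φ (α * I)).re - l * α - ε * α ^ 4) =
      ‖h (α * I) * Complex.exp (Ψ (α * I) - ε * (α * I) ^ 4)‖ := by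
    rw [norm_mul, Complex.norm_exp]
    congr 2
    rw [sub_re, re_ofReal_mul, re_pow_four]
    simp [hΨ]
    ring
  rw [hl, K]
  refine (norm_add_le _ _).trans (add_le_add ?_ ?_)
  · have := holder_P hα p hp h0 (fun x : ℝ => Pker α x * Complex.exp (Ψ x - ε * (x:ℂ) ^ 4)) hm0 1
      zero_le_one (by
        intro x
        have hP := Pker_pos hα x
        rw [norm_mul, Complex.norm_real, Real.norm_of_nonneg hP.le, Complex.norm_exp, one_mul,
          sub_eq_add_neg 1 (p⁻¹).toReal, Real.rpow_add hP, Real.rpow_one]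
        apply mul_le_mul_of_nonneg_left _ hP.le
        rw [Real.rpow_def_of_pos hP, Real.exp_le_exp, sub_re, re_ofReal_mul, re_pow_four]
        have h1 := hΦ.bot x
        simp [hΨ, h1]
        have : 0 ≤ ε * x ^ 4 := by positivity
        nlinarith)
    rw [one_mul] at this
    exact this
  · have hα' := one_sub_mem hα
    have := holder_P hα' q hq h1
      (fun x : ℝ => Pker (1 - α) x * Complex.exp (Ψ (x + I) - ε * ((x:ℂ) + I) ^ 4)) hm1
      (Real.exp (-l + 8 * ε)) (Real.exp_pos _).le (by
        intro x
        have hP := Pker_pos hα' x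
        rw [norm_mul, Complex.norm_real, Real.norm_of_nonneg hP.le, Complex.norm_exp,
          sub_eq_add_neg 1 (q⁻¹).toReal, Real.rpow_add hP, Real.rpow_one, mul_left_comm]
        apply mul_le_mul_of_nonneg_left _ hP.le
        rw [Real.rpow_def_of_pos hP, ← Real.exp_add, Real.exp_le_exp, sub_re, re_ofReal_mul]
        have h1 := hΦ.top x
        have h2 := re_top_four x
        have h3 : (Ψ (x + I)).re = -((q⁻¹).toReal * Real.log (Pker (1 - α) x)) - l := by
          simp [hΨ, h1]; ring
        rw [h3]
        nlinarith)
    rw [sub_sub_cancel] at this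
    exact this

def Cst (α s t R : ℝ) : ℝ := Real.exp R * (((1 - α) ^ (-s)) ^ (1 - α) * (α ^ (-t)) ^ α)

lemma Cst_pos {α : ℝ} (hα : α ∈ Ioo (0:ℝ) 1) (s t R : ℝ) : 0 < Cst α s t R := by
  have h1 := hα.1
  have h2 : 0 < 1 - α := by linarith [hα.2]
  unfold Cst; positivity

lemma opt_arith {α : ℝ} (hα : α ∈ Ioo (0:ℝ) 1) (s t R a b H : ℝ) (ha : 0 < a) (hb : 0 < b)
    (hH : ∀ l : ℝ, H * Real.exp (-R - l * α) ≤ (1 - α) ^ (1 - s) * a +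
      Real.exp (-l) * (α ^ (1 - t) * b)) :
    H ≤ Cst α s t R * (a ^ (1 - α) * b ^ α) := by
  have h1 := hα.1
  have h2 : 0 < 1 - α := by linarith [hα.2]
  set A := (1 - α) ^ (-s) * a with hA
  set B := α ^ (-t) * b with hB
  have hA0 : 0 < A := by positivity
  have hB0 : 0 < B := by positivity
  have e1 : (1 - α) ^ (1 - s) * a = (1 - α) * A := by
    rw [hA, sub_eq_add_neg 1 s, Real.rpow_add h2, Real.rpow_one]; ring
  have e2 : α ^ (1 - t) * b = α * B := by
    rw [hB, sub_eq_add_neg 1 t, Real.rpow_add h1, Real.rpow_one]; ring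
  have h := hH (Real.log (B / A))
  rw [e1, e2, Real.exp_neg, Real.exp_log (by positivity)] at h
  have e3 : (1 - α) * A + (B / A)⁻¹ * (α * B) = A := by field_simp; ring
  rw [e3, sub_eq_add_neg, Real.exp_add, Real.exp_neg] at h
  have e4 : Real.exp (-Real.log (B / A) * α) = (A / B) ^ α := by
    rw [Real.rpow_def_of_pos (by positivity), ← Real.log_inv, inv_div]
  have e5 : Real.exp (-(Real.log (B / A) * α)) = (A / B) ^ α := by
    rw [← e4]; ring_nf
  have h' : H * ((Real.exp R)⁻¹ * (A / B) ^ α) ≤ A := by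
    rw [← e5]; exact h
  have hR := Real.exp_pos R
  have h6 : H ≤ Real.exp R * (A * ((A / B) ^ α)⁻¹) := by
    have h7 : 0 < (A / B) ^ α := by positivity
    have : H = (H * ((Real.exp R)⁻¹ * (A / B) ^ α)) * (Real.exp R * ((A / B) ^ α)⁻¹) := by
      field_simp
    rw [this]
    calc _ ≤ A * (Real.exp R * ((A / B) ^ α)⁻¹) := by gcongr
      _ = _ := by ring
  refine h6.trans (le_of_eq ?_)
  have e7 : A * ((A / B) ^ α)⁻¹ = A ^ (1 - α) * B ^ α := by
    rw [Real.div_rpow hA0.le hB0.le, Real.rpow_sub hA0, Real.rpow_one, inv_div]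
    ring
  rw [e7, hA, hB, Real.mul_rpow (by positivity) ha.le, Real.mul_rpow (by positivity) hb.le]
  unfold Cst
  ring

lemma upper0 {α : ℝ} (hα : α ∈ Ioo (0:ℝ) 1) {h : ℂ → ℂ} (hh : DifferentiableOn ℂ h Strip)
    {Cw : ℝ}
    (hw : ∀ y ∈ Ioo (0:ℝ) 1,
      Integrable (fun x : ℝ => ‖h (x + y * I)‖ * Real.exp (-|x|)) ∧
      ∫ x : ℝ, ‖h (x + y * I)‖ * Real.exp (-|x|) ≤ Cw)
    {h0 h1 : ℝ → ℂ} (ht0 : IsTrace0 h h0) (ht1 : IsTrace1 h h1)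
    {p q : ℝ≥0∞} (hp : 1 ≤ p) (hq : 1 ≤ q) (hm0 : MemLp h0 p volume) (hm1 : MemLp h1 q volume)
    {Φ : ℂ → ℂ} (hΦ : IsPhi α (p⁻¹).toReal (q⁻¹).toReal Φ)
    (ha : 0 < (eLpNorm h0 p volume).toReal) (hb : 0 < (eLpNorm h1 q volume).toReal) :
    ‖h (α * I)‖ ≤ Cst α (p⁻¹).toReal (q⁻¹).toReal (Φ (α * I)).re *
      ((eLpNorm h0 p volume).toReal ^ (1 - α) * (eLpNorm h1 q volume).toReal ^ α) := by
  apply opt_arith hα _ _ _ _ _ _ ha hb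
  intro l
  have e1 : Continuous fun ε : ℝ =>
      ‖h (α * I)‖ * Real.exp (-(Φ (α * I)).re - l * α - ε * α ^ 4) := by fun_prop
  have e2 : Continuous fun ε : ℝ => (1 - α) ^ (1 - (p⁻¹).toReal) * (eLpNorm h0 p volume).toReal +
      Real.exp (-l + 8 * ε) * (α ^ (1 - (q⁻¹).toReal) * (eLpNorm h1 q volume).toReal) := by
    fun_prop
  have t1 := (e1.tendsto 0).mono_left (nhdsWithin_le_nhds (s := Ioi 0))
  have t2 := (e2.tendsto 0).mono_left (nhdsWithin_le_nhds (s := Ioi 0))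
  have := le_of_tendsto_of_tendsto t1 t2 (by
    filter_upwards [self_mem_nhdsWithin] with ε hε
    exact upper_eps hα hh hw ht0 ht1 hp hq hm0 hm1 hΦ l ε hε)
  simpa using this

lemma trace_shift {h : ℂ → ℂ} {v : ℝ → ℂ} {l : Filter ℝ} (a : ℝ)
    (ht : ∀ φ : SchwartzMap ℝ ℂ,
      Tendsto (fun y : ℝ => ∫ x : ℝ, h (x + y * Complex.I) * (starRingEnd ℂ) (φ x))
      l (𝓝 (∫ x : ℝ, v x * (starRingEnd ℂ) (φ x)))) :
    ∀ φ : SchwartzMap ℝ ℂ,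
      Tendsto (fun y : ℝ => ∫ x : ℝ, h (x + y * Complex.I + a) * (starRingEnd ℂ) (φ x))
      l (𝓝 (∫ x : ℝ, v (x + a) * (starRingEnd ℂ) (φ x))) := by
  intro φ
  have h1 := ht (φ.compSubConstCLM ℝ a)
  simp only [SchwartzMap.compSubConstCLM_apply] at h1
  have e1 : ∀ y : ℝ, ∫ x : ℝ, h (x + y * Complex.I) * (starRingEnd ℂ) (φ (x - a)) =
      ∫ x : ℝ, h (x + y * Complex.I + a) * (starRingEnd ℂ) (φ x) := by
    intro y
    rw [← integral_add_right_eq_self _ a]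
    congr 1; ext x
    rw [add_sub_cancel_right]; push_cast; congr 2; ring
  have e2 : ∫ x : ℝ, v x * (starRingEnd ℂ) (φ (x - a)) =
      ∫ x : ℝ, v (x + a) * (starRingEnd ℂ) (φ x) := by
    rw [← integral_add_right_eq_self _ a]
    congr 1; ext x
    rw [add_sub_cancel_right]
  rw [e2] at h1
  simpa only [e1] using h1

lemma upper {α : ℝ} (hα : α ∈ Ioo (0:ℝ) 1) {p q : ℝ≥0∞} (hp : 1 ≤ p) (hq : 1 ≤ q)
    {h : ℂ → ℂ} (hh : MemHardy p q h)
    {h0 h1 : ℝ → ℂ} (ht0 : IsTrace0 h h0) (ht1 : IsTrace1 h h1)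
    (hm0 : MemLp h0 p volume) (hm1 : MemLp h1 q volume)
    {Φ : ℂ → ℂ} (hΦ : IsPhi α (p⁻¹).toReal (q⁻¹).toReal Φ)
    (ha : 0 < (eLpNorm h0 p volume).toReal) (hb : 0 < (eLpNorm h1 q volume).toReal) (a : ℝ) :
    ‖h (a + α * I)‖ ≤ Cst α (p⁻¹).toReal (q⁻¹).toReal (Φ (α * I)).re *
      ((eLpNorm h0 p volume).toReal ^ (1 - α) * (eLpNorm h1 q volume).toReal ^ α) := by
  obtain ⟨Cw, hCw0, hw⟩ := weak_int hp hq hh.2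
  have mp : MeasurePreserving (fun x : ℝ => x + a) volume volume :=
    measurePreserving_add_right volume a
  have n0 : eLpNorm (fun x => h0 (x + a)) p volume = eLpNorm h0 p volume :=
    eLpNorm_comp_measurePreserving hm0.1 mp
  have n1 : eLpNorm (fun x => h1 (x + a)) q volume = eLpNorm h1 q volume :=
    eLpNorm_comp_measurePreserving hm1.1 mp
  have hhd : DifferentiableOn ℂ (fun z => h (z + a)) Strip := by
    apply hh.1.comp (by fun_prop)
    intro z hz
    constructor <;> simp [hz.1, hz.2]
  have hw' : ∀ y ∈ Ioo (0:ℝ) 1,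
      Integrable (fun x : ℝ => ‖h (x + y * I + a)‖ * Real.exp (-|x|)) ∧
      ∫ x : ℝ, ‖h (x + y * I + a)‖ * Real.exp (-|x|) ≤ Real.exp |a| * Cw := by
    intro y hy
    obtain ⟨hi, hb⟩ := hw y hy
    have hi2 : Integrable fun x : ℝ => Real.exp |a| *
        (‖h ((x + a : ℝ) + y * I)‖ * Real.exp (-|x + a|)) :=
      (hi.comp_add_right a).const_mul _
    have hle : ∀ x : ℝ, ‖h (x + y * I + a)‖ * Real.exp (-|x|) ≤ Real.exp |a| *
        (‖h ((x + a : ℝ) + y * I)‖ * Real.exp (-|x + a|)) := by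
      intro x
      rw [show ((x + a : ℝ) : ℂ) + y * I = x + y * I + a by push_cast; ring, mul_left_comm,
        ← Real.exp_add]
      apply mul_le_mul_of_nonneg_left _ (norm_nonneg _)
      rw [Real.exp_le_exp]
      have := abs_add_le x a
      linarith
    have hi3 : Integrable (fun x : ℝ => ‖h (x + y * I + a)‖ * Real.exp (-|x|)) := by
      refine hi2.mono' ?_ (Eventually.of_forall fun x => ?_)
      · have := line_cont hhd hy
        exact (this.norm.mul (by fun_prop)).aestronglyMeasurable
      · rw [Real.norm_of_nonneg (by positivity)]; exact hle x
    refine ⟨hi3, (integral_mono hi3 hi2 hle).trans ?_⟩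
    rw [integral_const_mul,
      integral_add_right_eq_self (fun x : ℝ => ‖h (x + y * I)‖ * Real.exp (-|x|)) a]
    exact mul_le_mul_of_nonneg_left hb (Real.exp_pos _).le
  have := upper0 (h := fun z => h (z + a)) (h0 := fun x => h0 (x + a)) (h1 := fun x => h1 (x + a))
    hα hhd hw' (trace_shift a ht0) (trace_shift a ht1) hp hq
    (hm0.comp_measurePreserving mp) (hm1.comp_measurePreserving mp) hΦ
    (by rw [n0]; exact ha) (by rw [n1]; exact hb)
  rw [n0, n1] at this
  rwa [add_comm (a:ℂ)]

lemma ratio_le {α : ℝ} (hα : α ∈ Ioo (0:ℝ) 1) {p q : ℝ≥0∞} (hp : 1 ≤ p) (hq : 1 ≤ q)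
    {Φ : ℂ → ℂ} (hΦ : IsPhi α (p⁻¹).toReal (q⁻¹).toReal Φ) (r : ℝ) (hr : r ∈ ratioSet p q α) :
    r ≤ Cst α (p⁻¹).toReal (q⁻¹).toReal (Φ (α * I)).re := by
  obtain ⟨h, h0, h1, hh, -, ht0, ht1, hm0, hm1, rfl⟩ := hr
  have hC := Cst_pos hα (p⁻¹).toReal (q⁻¹).toReal (Φ (α * I)).re
  have hα0 := hα.1
  have hα1 : 0 < 1 - α := by linarith [hα.2]
  rcases (ENNReal.toReal_nonneg (a := eLpNorm h0 p volume)).eq_or_lt with ha | ha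
  · rw [← ha, Real.zero_rpow hα1.ne']; simpa using hC.le
  rcases (ENNReal.toReal_nonneg (a := eLpNorm h1 q volume)).eq_or_lt with hb | hb
  · rw [← hb, Real.zero_rpow hα0.ne']; simpa using hC.le
  rw [div_le_iff₀ (by positivity)]
  apply ENNReal.toReal_le_of_le_ofReal (by positivity)
  rw [eLpNorm_exponent_top]
  apply eLpNormEssSup_le_of_ae_bound
  exact Eventually.of_forall fun x => upper hα hp hq hh ht0 ht1 hm0 hm1 hΦ ha hb x

/-- facts available for a holomorphic function on `Ust α` with exponential decay -/
lemma decay_memHardy {α : ℝ} (hα : α ∈ Ioo (0:ℝ) 1) {h : ℂ → ℂ} (hd : DifferentiableOn ℂ h (Ust α))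
    {C : ℝ} (hC : ∀ z ∈ Ust α, ‖h z‖ ≤ C * Real.exp (-|z.re|))
    {p q : ℝ≥0∞} (hp : 1 ≤ p) (hq : 1 ≤ q) : MemHardy p q h := by
  have hs : Strip ⊆ Ust α := fun z hz => closed_sub_Ust hα z hz.1.le hz.2.le
  refine ⟨hd.mono hs, ?_⟩
  set B : ℝ≥0∞ := ENNReal.ofReal C * eLpNorm (fun x : ℝ => Real.exp (-|x|)) p volume +
    ENNReal.ofReal C * eLpNorm (fun x : ℝ => Real.exp (-|x|)) q volume with hB
  have hBt : B < ⊤ := by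
    rw [hB, ENNReal.add_lt_top]
    exact ⟨ENNReal.mul_lt_top ENNReal.ofReal_lt_top (memLp_exp_abs p hp).2,
      ENNReal.mul_lt_top ENNReal.ofReal_lt_top (memLp_exp_abs q hq).2⟩
  refine lt_of_le_of_lt ?_ hBt
  unfold hardyNorm
  refine iSup₂_le fun y hy => ?_
  have hcont : Continuous (bLine h y) := line_cont (hd.mono hs) hy
  have hy0 := hy.1
  have hy1 : 0 < 1 - y := by linarith [hy.2]
  have hbd : ∀ r : ℝ≥0∞, eLpNorm (bLine h y) r volume ≤
      ENNReal.ofReal C * eLpNorm (fun x : ℝ => Real.exp (-|x|)) r volume := by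
    intro r
    apply eLpNorm_le_mul_eLpNorm_of_ae_le_mul
    refine Eventually.of_forall fun x => ?_
    have := hC ((x:ℂ) + y * I) (closed_sub_Ust hα _ (by simpa using hy0.le)
      (by simpa using hy.2.le))
    rw [Real.norm_of_nonneg (Real.exp_pos _).le]
    simpa [bLine] using this
  have hsc : ∀ (c : ℝ), 0 < c → ∀ r : ℝ≥0∞,
      ENNReal.ofReal c⁻¹ * eLpNorm (fun x => (c:ℂ) * bLine h y x) r volume =
      eLpNorm (bLine h y) r volume := by
    intro c hc r
    have e1 : (fun x => (c:ℂ) * bLine h y x) = (c:ℂ) • bLine h y := by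
      ext x; simp
    rw [e1, eLpNorm_const_smul, ← mul_assoc]
    have e2 : ‖(c:ℂ)‖ₑ = ENNReal.ofReal c := by
      rw [← ofReal_norm, Complex.norm_real, Real.norm_of_nonneg hc.le]
    rw [e2, ← ENNReal.ofReal_mul (by positivity), inv_mul_cancel₀ hc.ne']
    simp
  refine iInf_le_of_le (fun x => ((1 - y : ℝ) : ℂ) * bLine h y x) ?_
  refine iInf_le_of_le (fun x => ((y : ℝ) : ℂ) * bLine h y x) ?_
  refine iInf_le_of_le (by fun_prop) ?_
  refine iInf_le_of_le (by fun_prop) ?_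
  refine iInf_le_of_le (by ext x; simp only [Pi.add_apply]; push_cast; ring) ?_
  rw [hsc _ hy1, hsc _ hy0, hB]
  exact add_le_add (hbd p) (hbd q)

lemma decay_trace {α : ℝ} (hα : α ∈ Ioo (0:ℝ) 1) {h : ℂ → ℂ} (hd : DifferentiableOn ℂ h (Ust α))
    {C : ℝ} (hC0 : 0 ≤ C) (hC : ∀ z ∈ Ust α, ‖h z‖ ≤ C * Real.exp (-|z.re|))
    {c : ℝ} (hc : c ∈ Icc (0:ℝ) 1) (l : Filter ℝ) [l.IsCountablyGenerated] (hl : l ≤ 𝓝 c)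
    (hl' : ∀ᶠ y in l, y ∈ Ioo (0:ℝ) 1) (φ : SchwartzMap ℝ ℂ) :
    Tendsto (fun y : ℝ => ∫ x : ℝ, h (x + y * Complex.I) * (starRingEnd ℂ) (φ x))
      l (𝓝 (∫ x : ℝ, h (x + c * I) * (starRingEnd ℂ) (φ x))) := by
  have hs : Strip ⊆ Ust α := fun z hz => closed_sub_Ust hα z hz.1.le hz.2.le
  apply tendsto_integral_filter_of_dominated_convergence (fun x => C * ‖φ x‖)
  · filter_upwards [hl'] with y hy
    exact ((line_cont (hd.mono hs) hy).mul
      (Complex.continuous_conj.comp φ.continuous)).aestronglyMeasurable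
  · filter_upwards [hl'] with y hy
    refine Eventually.of_forall fun x => ?_
    have h1 := hC ((x:ℂ) + y * I) (closed_sub_Ust hα _ (by simpa using hy.1.le)
      (by simpa using hy.2.le))
    have h2 : Real.exp (-|((x:ℂ) + y * I).re|) ≤ 1 := by rw [Real.exp_le_one_iff]; simp
    rw [norm_mul, RCLike.norm_conj]
    apply mul_le_mul_of_nonneg_right _ (norm_nonneg _)
    nlinarith
  · exact φ.integrable.norm.const_mul C
  · refine Eventually.of_forall fun x => ?_
    apply Tendsto.mul_const
    have hU : ((x:ℂ) + c * I) ∈ Ust α := closed_sub_Ust hα _ (by simpa using hc.1)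
      (by simpa using hc.2)
    have h1 : ContinuousAt h ((x:ℂ) + c * I) :=
      (hd.differentiableAt ((isOpen_Ust α).mem_nhds hU)).continuousAt
    have h2 : Tendsto (fun y : ℝ => (x:ℂ) + y * I) l (𝓝 ((x:ℂ) + c * I)) := by
      have : Continuous fun y : ℝ => (x:ℂ) + y * I := by fun_prop
      exact (this.tendsto c).mono_left hl
    exact h1.tendsto.comp h2

lemma le_essSup_of_cont {f : ℝ → ℂ} (hf : Continuous f) (x : ℝ) :
    ‖f x‖ₑ ≤ eLpNorm f ⊤ volume := by
  rw [eLpNorm_exponent_top]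
  have h1 : ∀ᵐ y ∂(volume : Measure ℝ), ‖f y‖ₑ ≤ eLpNormEssSup f volume := ae_le_eLpNormEssSup
  have h2 : Dense {y | ‖f y‖ₑ ≤ eLpNormEssSup f volume} := Measure.dense_of_ae h1
  have h3 : IsClosed {y | ‖f y‖ₑ ≤ eLpNormEssSup f volume} :=
    isClosed_le hf.enorm continuous_const
  have h4 := h3.closure_eq ▸ h2.closure_eq
  have : x ∈ {y | ‖f y‖ₑ ≤ eLpNormEssSup f volume} := by rw [h4]; trivial
  exact this

lemma eLp_pos {f : ℝ → ℂ} (hf : ∀ x, f x ≠ 0) {p : ℝ≥0∞} (hp : 1 ≤ p) (hm : MemLp f p volume) :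
    0 < (eLpNorm f p volume).toReal := by
  apply ENNReal.toReal_pos _ hm.2.ne
  intro h0
  rw [eLpNorm_eq_zero_iff hm.1 (one_pos.trans_le hp).ne'] at h0
  obtain ⟨x, hx⟩ := h0.exists
  exact hf x hx

lemma lower_eps {α : ℝ} (hα : α ∈ Ioo (0:ℝ) 1) {p q : ℝ≥0∞} (hp : 1 ≤ p) (hq : 1 ≤ q)
    {Φ : ℂ → ℂ} (hΦ : IsPhi α (p⁻¹).toReal (q⁻¹).toReal Φ) (ε : ℝ) (hε : 0 < ε) :
    ∃ r ∈ ratioSet p q α, Real.exp ((Φ (α * I)).re - ε * α ^ 4) /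
      (((1 - α) ^ (p⁻¹).toReal) ^ (1 - α) * (Real.exp (8 * ε) * α ^ (q⁻¹).toReal) ^ α) ≤ r := by
  obtain ⟨C0, hC0⟩ := hΦ.bd
  obtain ⟨C, hCn, hC⟩ := damp hα Φ C0 hC0 ε hε
  have hα0 := hα.1
  have hα1 : 0 < 1 - α := by linarith [hα.2]
  have hα' := one_sub_mem hα
  set h : ℂ → ℂ := fun z => Complex.exp (Φ z - ε * z ^ 4) with hh
  have hd : DifferentiableOn ℂ h (Ust α) := by
    have := hΦ.diff
    fun_prop
  have hlc : ∀ y ∈ Icc (0:ℝ) 1, Continuous fun x : ℝ => h (x + y * I) := by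
    intro y hy
    apply hd.continuousOn.comp_continuous (by fun_prop)
    intro x
    exact closed_sub_Ust hα _ (by simpa using hy.1) (by simpa using hy.2)
  have z0 : (0:ℝ) ∈ Icc (0:ℝ) 1 := by simp
  have z1 : (1:ℝ) ∈ Icc (0:ℝ) 1 := by simp
  have n0 : eLpNorm (fun x : ℝ => h (x + (0:ℝ) * I)) p volume ≤
      ENNReal.ofReal ((1 - α) ^ (p⁻¹).toReal) := by
    have := eLpNorm_le_mul_eLpNorm_of_ae_le_mul (μ := (volume : Measure ℝ)) (c := 1)
      (f := fun x : ℝ => h (x + (0:ℝ) * I)) (g := fun x => Pker α x ^ (p⁻¹).toReal)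
      (Eventually.of_forall (by
        intro x
        have hP := Pker_pos hα x
        have e : (x:ℂ) + (0:ℝ) * I = x := by simp
        rw [e, one_mul, Real.norm_of_nonneg (by positivity)]
        simp only [hh]
        rw [Complex.norm_exp, Real.rpow_def_of_pos hP, Real.exp_le_exp, sub_re, re_ofReal_mul,
          re_pow_four, hΦ.bot x]
        have : 0 ≤ ε * x ^ 4 := by positivity
        simp
        nlinarith)) p
    rw [Pker_eLp hα p hp] at this
    simpa using this
  have n1 : eLpNorm (fun x : ℝ => h (x + (1:ℝ) * I)) q volume ≤
      ENNReal.ofReal (Real.exp (8 * ε) * α ^ (q⁻¹).toReal) := by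
    have := eLpNorm_le_mul_eLpNorm_of_ae_le_mul (μ := (volume : Measure ℝ)) (c := Real.exp (8 * ε))
      (f := fun x : ℝ => h (x + (1:ℝ) * I)) (g := fun x => Pker (1 - α) x ^ (q⁻¹).toReal)
      (Eventually.of_forall (by
        intro x
        have hP := Pker_pos hα' x
        have e : (x:ℂ) + (1:ℝ) * I = x + I := by simp
        rw [e, Real.norm_of_nonneg (by positivity)]
        simp only [hh]
        rw [Complex.norm_exp, Real.rpow_def_of_pos hP, ← Real.exp_add, Real.exp_le_exp, sub_re,
          re_ofReal_mul, hΦ.top x]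
        have := re_top_four x
        nlinarith)) q
    rw [Pker_eLp hα' q hq, sub_sub_cancel, ← ENNReal.ofReal_mul (Real.exp_pos _).le] at this
    exact this
  have m0 : MemLp (fun x : ℝ => h (x + (0:ℝ) * I)) p volume :=
    ⟨(hlc 0 z0).aestronglyMeasurable, n0.trans_lt ENNReal.ofReal_lt_top⟩
  have m1 : MemLp (fun x : ℝ => h (x + (1:ℝ) * I)) q volume :=
    ⟨(hlc 1 z1).aestronglyMeasurable, n1.trans_lt ENNReal.ofReal_lt_top⟩
  have hne : ∀ z, h z ≠ 0 := fun z => Complex.exp_ne_zero _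
  have p0 := eLp_pos (fun x => hne _) hp m0
  have p1 := eLp_pos (fun x => hne _) hq m1
  refine ⟨_, ⟨h, fun x : ℝ => h (x + (0:ℝ) * I), fun x : ℝ => h (x + (1:ℝ) * I),
    decay_memHardy hα hd hC hp hq, ⟨α * I, ⟨by simpa using hα.1, by simpa using hα.2⟩, hne _⟩,
    decay_trace hα hd hCn hC z0 _ nhdsWithin_le_nhds (Ioo_mem_nhdsGT one_pos),
    decay_trace hα hd hCn hC z1 _ nhdsWithin_le_nhds (Ioo_mem_nhdsLT one_pos), m0, m1, rfl⟩, ?_⟩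
  have hbc : Continuous (bLine h α) := hlc α ⟨hα.1.le, hα.2.le⟩
  have hfin : eLpNorm (bLine h α) ⊤ volume ≠ ⊤ := by
    have : MemLp (bLine h α) ⊤ volume := by
      refine memLp_top_of_bound hbc.aestronglyMeasurable C (Eventually.of_forall fun x => ?_)
      have h1 := hC ((x:ℂ) + α * I) (closed_sub_Ust hα _ (by simpa using hα.1.le)
        (by simpa using hα.2.le))
      have h2 : Real.exp (-|((x:ℂ) + α * I).re|) ≤ 1 := by rw [Real.exp_le_one_iff]; simp
      exact h1.trans (by nlinarith)
    exact this.2.ne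
  have hnum : Real.exp ((Φ (α * I)).re - ε * α ^ 4) ≤ (eLpNorm (bLine h α) ⊤ volume).toReal := by
    have h1 := ENNReal.toReal_mono hfin (le_essSup_of_cont hbc 0)
    rw [toReal_enorm] at h1
    refine le_trans (le_of_eq ?_) h1
    have e : bLine h α 0 = h (α * I) := by simp [bLine]
    rw [e]
    simp only [hh]
    rw [Complex.norm_exp, sub_re, re_ofReal_mul, re_pow_four]
    simp
  have a0 : (eLpNorm (fun x : ℝ => h (x + (0:ℝ) * I)) p volume).toReal ≤
      (1 - α) ^ (p⁻¹).toReal := ENNReal.toReal_le_of_le_ofReal (by positivity) n0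
  have a1 : (eLpNorm (fun x : ℝ => h (x + (1:ℝ) * I)) q volume).toReal ≤
      Real.exp (8 * ε) * α ^ (q⁻¹).toReal := ENNReal.toReal_le_of_le_ofReal (by positivity) n1
  gcongr

lemma Hval_eq {α : ℝ} (hα : α ∈ Ioo (0:ℝ) 1) {p q : ℝ≥0∞} (hp : 1 ≤ p) (hq : 1 ≤ q)
    {Φ : ℂ → ℂ} (hΦ : IsPhi α (p⁻¹).toReal (q⁻¹).toReal Φ) :
    Hval p q α = Cst α (p⁻¹).toReal (q⁻¹).toReal (Φ (α * I)).re := by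
  have hα0 := hα.1
  have hα1 : 0 < 1 - α := by linarith [hα.2]
  have hbdd : BddAbove (ratioSet p q α) := ⟨_, fun r hr => ratio_le hα hp hq hΦ r hr⟩
  unfold Hval
  apply le_antisymm
  · obtain ⟨r, hr, -⟩ := lower_eps hα hp hq hΦ 1 one_pos
    exact csSup_le ⟨r, hr⟩ fun r hr => ratio_le hα hp hq hΦ r hr
  · set F : ℝ → ℝ := fun ε => Real.exp ((Φ (α * I)).re - ε * α ^ 4) /
      (((1 - α) ^ (p⁻¹).toReal) ^ (1 - α) * (Real.exp (8 * ε) * α ^ (q⁻¹).toReal) ^ α) with hF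
    have hFc : Continuous F := by
      apply Continuous.div
      · fun_prop
      · apply Continuous.mul continuous_const
        apply Continuous.rpow_const (by fun_prop)
        intro x; right; exact hα0.le
      · intro x; positivity
    have t := (hFc.tendsto 0).mono_left (nhdsWithin_le_nhds (s := Ioi 0))
    have e : F 0 = Cst α (p⁻¹).toReal (q⁻¹).toReal (Φ (α * I)).re := by
      simp only [hF, Cst]
      rw [Real.rpow_neg hα1.le, Real.rpow_neg hα0.le, Real.inv_rpow (by positivity),
        Real.inv_rpow (by positivity), ← mul_inv]
      simp [div_eq_mul_inv]
    rw [← e]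
    apply le_of_tendsto t
    filter_upwards [self_mem_nhdsWithin] with ε hε
    obtain ⟨r, hr, hle⟩ := lower_eps hα hp hq hΦ ε hε
    exact hle.trans (le_csSup hbdd hr)

lemma P_log_integral {α : ℝ} (hα : α ∈ Ioo (0:ℝ) 1) :
    ∫ x : ℝ, Pker α x * Real.log (Pker α x / (1 - α)) =
      (∫ x : ℝ, Pker α x * Real.log (Pker α x)) - (1 - α) * Real.log (1 - α) := by
  obtain ⟨e, he, ⟨C, hC⟩, h0, h1⟩ := exists_e hα
  have hi := (e_value hα e he ⟨C, hC⟩ h0 h1).1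
  obtain ⟨hP, hPv⟩ := Pker_integral hα
  have hα1 : 0 < 1 - α := by linarith [hα.2]
  have e : (fun x : ℝ => Pker α x * Real.log (Pker α x / (1 - α))) =
      fun x => Pker α x * Real.log (Pker α x) - Pker α x * Real.log (1 - α) := by
    ext x
    rw [Real.log_div (Pker_pos hα x).ne' hα1.ne']; ring
  rw [e, integral_sub hi (hP.mul_const _), integral_mul_const, hPv]

/-- **Optimal value** (Theorem 1.5, general formula): the value of `H_{p,q}(α)`. -/
theorem log_H_pq (α : ℝ) (hα : α ∈ Set.Ioo (0:ℝ) 1) (p q : ℝ≥0∞)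
    (hp : 1 ≤ p) (hq : 1 ≤ q) :
    Real.log (Hval p q α) =
      (p⁻¹).toReal * (∫ x : ℝ, Pker α x * Real.log (Pker α x / (1 - α))) +
      (q⁻¹).toReal * (∫ x : ℝ, Pker (1 - α) x * Real.log (Pker (1 - α) x / α)) := by
  obtain ⟨Φ, h1, h2, h3, h4, h5⟩ := exists_Phi hα (p⁻¹).toReal (q⁻¹).toReal
  have hα0 := hα.1
  have hα1 : 0 < 1 - α := by linarith [hα.2]
  have i1 := P_log_integral hα
  have i2 := P_log_integral (one_sub_mem hα)
  rw [sub_sub_cancel] at i2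
  rw [i1, i2, Hval_eq hα hp hq ⟨h1, h2, h3, h4⟩]
  unfold Cst
  rw [Real.log_mul (Real.exp_pos _).ne' (by positivity), Real.log_exp,
    Real.log_mul (by positivity) (by positivity), Real.log_rpow (Real.rpow_pos_of_pos hα1 _),
    Real.log_rpow (Real.rpow_pos_of_pos hα0 _), Real.log_rpow hα1, Real.log_rpow hα0, h5]
  ring
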